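/- arXiv:1809.09200 — 10 statements merged into one kernel-verified Lean document; each statement's English description precedes it below -/
import Mathlib

section
/- Fix real parameters ρ > 0, θ > 0, τ > 0, κ > 0, e_θ > 0, p_ρ > 0, p_θ > 0 and u ∈ ℝ. Set E := p_ρ + κ/(ρ e_θ τ) + θ p_θ²/(ρ² e_θ) and F := κ p_ρ/(ρ e_θ τ), and define ζ₁ := u − √((E + √(E² − 4F))/2), ζ₂ := u − √((E − √(E² − 4F))/2), ζ₃ := u + √((E − √(E² − 4F))/2), ζ₄ := u + √((E + √(E² − 4F))/2). Then ζ₁ < ζ₂ < ζ₃ < ζ₄, and for every ζ ∈ ℝ one has det(A¹ − ζ A⁰) = 0 if and only if ζ ∈ {ζ₁, ζ₂, ζ₃, ζ₄}; that is, the first-order Cattaneo–Christov system A⁰U_t + A¹U_x = 0 is strictly hyperbolic with these four characteristic speeds. -/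
/-- The coefficient matrix `A⁰ = diag(1, ρ, ρ e_θ, τ)` of the one-dimensional
Cattaneo–Christov system. -/
def A0 (ρ θ τ κ eθ pρ pθ u : ℝ) : Matrix (Fin 4) (Fin 4) ℝ :=
  !![1, 0, 0, 0;
     0, ρ, 0, 0;
     0, 0, ρ * eθ, 0;
     0, 0, 0, τ]

/-- The coefficient matrix `A¹` of the one-dimensional Cattaneo–Christov system. -/
def A1 (ρ θ τ κ eθ pρ pθ u : ℝ) : Matrix (Fin 4) (Fin 4) ℝ :=
  !![u, ρ, 0, 0;
     pρ, ρ * u, pθ, 0;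
     0, θ * pθ, ρ * u * eθ, 1;
     0, 0, κ, τ * u]

theorem biquadratic_discrim_pos {a b c : ℝ} (ha : 0 < a) (hb : 0 < b) (hc : 0 < c) :
    0 < (a + b + c) ^ 2 - 4 * (b * a) := by
  have : (a + b + c) ^ 2 - 4 * (b * a) = (a - b) ^ 2 + c * (2 * a + 2 * b + c) := by ring
  rw [this]
  positivity

/-- If `E > 0`, `F > 0` and `E² > 4F`, then the roots of `(u - ζ)⁴ - E (u - ζ)² + F` are four
distinct real numbers, given by the biquadratic formula. -/
theorem biquadratic_roots {E F : ℝ} (u : ℝ) (hE : 0 < E) (hF : 0 < F)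
    (hD : 0 < E ^ 2 - 4 * F) :
    u - √((E + √(E ^ 2 - 4 * F)) / 2) < u - √((E - √(E ^ 2 - 4 * F)) / 2) ∧
    u - √((E - √(E ^ 2 - 4 * F)) / 2) < u + √((E - √(E ^ 2 - 4 * F)) / 2) ∧
    u + √((E - √(E ^ 2 - 4 * F)) / 2) < u + √((E + √(E ^ 2 - 4 * F)) / 2) ∧
    ∀ ζ : ℝ, (u - ζ) ^ 4 - E * (u - ζ) ^ 2 + F = 0 ↔
      ζ = u - √((E + √(E ^ 2 - 4 * F)) / 2) ∨ ζ = u - √((E - √(E ^ 2 - 4 * F)) / 2) ∨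
      ζ = u + √((E - √(E ^ 2 - 4 * F)) / 2) ∨ ζ = u + √((E + √(E ^ 2 - 4 * F)) / 2) := by
  have hs : 0 < √(E ^ 2 - 4 * F) := Real.sqrt_pos.mpr hD
  have hs2 : √(E ^ 2 - 4 * F) ^ 2 = E ^ 2 - 4 * F := Real.sq_sqrt hD.le
  have hsE : √(E ^ 2 - 4 * F) < E := (Real.sqrt_lt' hE).mpr (by linarith)
  generalize √(E ^ 2 - 4 * F) = s at *
  have hm : 0 < (E - s) / 2 := by linarith
  have hp : 0 < (E + s) / 2 := by linarith
  have hy : 0 < √((E - s) / 2) := Real.sqrt_pos.mpr hm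
  have hxy : √((E - s) / 2) < √((E + s) / 2) := Real.sqrt_lt_sqrt hm.le (by linarith)
  have hy2 : √((E - s) / 2) ^ 2 = (E - s) / 2 := Real.sq_sqrt hm.le
  have hx2 : √((E + s) / 2) ^ 2 = (E + s) / 2 := Real.sq_sqrt hp.le
  generalize √((E - s) / 2) = y at *
  generalize √((E + s) / 2) = x at *
  refine ⟨by linarith, by linarith, by linarith, fun ζ => ?_⟩
  have hE' : E = x ^ 2 + y ^ 2 := by linarith
  have hF' : F = x ^ 2 * y ^ 2 := by
    rw [hx2, hy2]
    linarith
  have key : (u - ζ) ^ 4 - E * (u - ζ) ^ 2 + F =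
      (ζ - (u - x)) * ((ζ - (u - y)) * ((ζ - (u + y)) * (ζ - (u + x)))) := by
    rw [hE', hF']
    ring
  rw [key]
  simp only [mul_eq_zero, sub_eq_zero]

/-- The characteristic polynomial of the Cattaneo–Christov system is biquadratic in `u - ζ`. -/
theorem det_A1_sub_smul_A0 {ρ τ eθ : ℝ} (θ κ pρ pθ u ζ : ℝ)
    (hρ : ρ ≠ 0) (hτ : τ ≠ 0) (heθ : eθ ≠ 0) :
    (A1 ρ θ τ κ eθ pρ pθ u - ζ • A0 ρ θ τ κ eθ pρ pθ u).det =
      ρ ^ 2 * eθ * τ * ((u - ζ) ^ 4 -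
        (pρ + κ / (ρ * eθ * τ) + θ * pθ ^ 2 / (ρ ^ 2 * eθ)) * (u - ζ) ^ 2 +
        κ * pρ / (ρ * eθ * τ)) := by
  simp [A0, A1, Matrix.det_succ_row_zero, Fin.sum_univ_succ, Fin.succAbove]
  field_simp
  ring

/-- Strict hyperbolicity of the one-dimensional Cattaneo–Christov system: the four
characteristic speeds `ζ₁ < ζ₂ < ζ₃ < ζ₄` given by Lemma 3.1 of the paper are real,
distinct, and are exactly the roots of `det(A¹ − ζ A⁰) = 0`. -/
theorem cattaneo_christov_strictly_hyperbolic (ρ θ τ κ eθ pρ pθ u : ℝ)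
    (hρ : 0 < ρ) (hθ : 0 < θ) (hτ : 0 < τ) (hκ : 0 < κ)
    (heθ : 0 < eθ) (hpρ : 0 < pρ) (hpθ : 0 < pθ) :
    let E : ℝ := pρ + κ / (ρ * eθ * τ) + θ * pθ ^ 2 / (ρ ^ 2 * eθ)
    let F : ℝ := κ * pρ / (ρ * eθ * τ)
    let ζ₁ : ℝ := u - Real.sqrt ((E + Real.sqrt (E ^ 2 - 4 * F)) / 2)
    let ζ₂ : ℝ := u - Real.sqrt ((E - Real.sqrt (E ^ 2 - 4 * F)) / 2)
    let ζ₃ : ℝ := u + Real.sqrt ((E - Real.sqrt (E ^ 2 - 4 * F)) / 2)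
    let ζ₄ : ℝ := u + Real.sqrt ((E + Real.sqrt (E ^ 2 - 4 * F)) / 2)
    ζ₁ < ζ₂ ∧ ζ₂ < ζ₃ ∧ ζ₃ < ζ₄ ∧
      ∀ ζ : ℝ,
        (A1 ρ θ τ κ eθ pρ pθ u - ζ • A0 ρ θ τ κ eθ pρ pθ u).det = 0 ↔
          ζ = ζ₁ ∨ ζ = ζ₂ ∨ ζ = ζ₃ ∨ ζ = ζ₄ := by
  intro E F ζ₁ ζ₂ ζ₃ ζ₄
  have hb : 0 < κ / (ρ * eθ * τ) := by positivity
  have hc : 0 < θ * pθ ^ 2 / (ρ ^ 2 * eθ) := by positivity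
  have hE : 0 < E := by positivity
  have hF : 0 < F := by positivity
  have hD : 0 < E ^ 2 - 4 * F := by
    have hFab : F = κ / (ρ * eθ * τ) * pρ := mul_div_right_comm κ pρ _
    rw [hFab]
    exact biquadratic_discrim_pos hpρ hb hc
  obtain ⟨h₁₂, h₂₃, h₃₄, hroots⟩ := biquadratic_roots u hE hF hD
  refine ⟨h₁₂, h₂₃, h₃₄, fun ζ => ?_⟩
  have hlead : ρ ^ 2 * eθ * τ ≠ 0 := by positivity
  rw [det_A1_sub_smul_A0 θ κ pρ pθ u ζ hρ.ne' hτ.ne' heθ.ne', mul_eq_zero_iff_left hlead]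
  exact hroots ζ
end

section
/- Fix real parameters ρ > 0, θ > 0, τ > 0, κ > 0, e_θ > 0, p_ρ > 0, p_θ > 0, u ∈ ℝ, ν ≥ 0, and let S := diag(p_ρ/ρ, 1, 1/θ, 1/(κθ)), B := diag(0, ν, 0, 0), D := diag(0, 0, 0, −1). Then S is symmetric and positive definite, and the products S·A⁰, S·A¹, S·B and S·D are all symmetric matrices; explicitly, S·A⁰ = Â⁰ and S·A¹ = Â¹. Moreover Â⁰ is positive definite, S·B is positive semidefinite, and −S·D = diag(0,0,0,1/(κθ)) is positive semidefinite. In other words, S is a symmetrizer for the Cattaneo–Christov system. -/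
/-- The symmetrizer `S = diag(p_ρ/ρ, 1, 1/θ, 1/(κθ))`. -/
noncomputable def S (ρ θ τ κ eθ pρ pθ u : ℝ) : Matrix (Fin 4) (Fin 4) ℝ :=
  !![pρ / ρ, 0, 0, 0;
     0, 1, 0, 0;
     0, 0, 1 / θ, 0;
     0, 0, 0, 1 / (κ * θ)]

/-- The viscosity matrix `B = diag(0, ν, 0, 0)`. -/
def Bmat (ν : ℝ) : Matrix (Fin 4) (Fin 4) ℝ :=
  !![0, 0, 0, 0;
     0, ν, 0, 0;
     0, 0, 0, 0;
     0, 0, 0, 0]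

/-- The relaxation matrix `D = diag(0, 0, 0, −1)`. -/
def Dmat : Matrix (Fin 4) (Fin 4) ℝ :=
  !![0, 0, 0, 0;
     0, 0, 0, 0;
     0, 0, 0, 0;
     0, 0, 0, -1]

/-- The symmetrized matrix `Â⁰ = S A⁰ = diag(p_ρ/ρ, ρ, ρ e_θ/θ, τ/(κθ))`. -/
noncomputable def hatA0 (ρ θ τ κ eθ pρ pθ u : ℝ) : Matrix (Fin 4) (Fin 4) ℝ :=
  !![pρ / ρ, 0, 0, 0;
     0, ρ, 0, 0;
     0, 0, ρ * eθ / θ, 0;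
     0, 0, 0, τ / (κ * θ)]

/-- The symmetrized matrix `Â¹ = S A¹`. -/
noncomputable def hatA1 (ρ θ τ κ eθ pρ pθ u : ℝ) : Matrix (Fin 4) (Fin 4) ℝ :=
  !![u * pρ / ρ, pρ, 0, 0;
     pρ, ρ * u, pθ, 0;
     0, pθ, ρ * u * eθ / θ, 1 / θ;
     0, 0, 1 / θ, τ * u / (κ * θ)]

/-- The diagonal matrix with entries `a`, `b`, `c`, `d`, written out entrywise. -/
theorem fin_four_eq_diagonal (a b c d : ℝ) :
    !![a, 0, 0, 0; 0, b, 0, 0; 0, 0, c, 0; 0, 0, 0, d] = Matrix.diagonal ![a, b, c, d] := by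
  ext i j
  fin_cases i <;> fin_cases j <;> simp [Matrix.diagonal]

theorem posDef_fin_four {a b c d : ℝ} (ha : 0 < a) (hb : 0 < b) (hc : 0 < c) (hd : 0 < d) :
    !![a, 0, 0, 0; 0, b, 0, 0; 0, 0, c, 0; 0, 0, 0, d].PosDef := by
  rw [fin_four_eq_diagonal]
  refine Matrix.PosDef.diagonal fun i => ?_
  fin_cases i <;> simpa

theorem posSemidef_fin_four {a b c d : ℝ} (ha : 0 ≤ a) (hb : 0 ≤ b) (hc : 0 ≤ c) (hd : 0 ≤ d) :
    !![a, 0, 0, 0; 0, b, 0, 0; 0, 0, c, 0; 0, 0, 0, d].PosSemidef := by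
  rw [fin_four_eq_diagonal]
  refine Matrix.PosSemidef.diagonal fun i => ?_
  fin_cases i <;> simpa

theorem isSymm_fin_four (a b c d : ℝ) :
    !![a, 0, 0, 0; 0, b, 0, 0; 0, 0, c, 0; 0, 0, 0, d].IsSymm := by
  rw [fin_four_eq_diagonal]
  exact Matrix.isSymm_diagonal _

theorem S_mul_A0 (ρ θ τ κ eθ pρ pθ u : ℝ) :
    S ρ θ τ κ eθ pρ pθ u * A0 ρ θ τ κ eθ pρ pθ u = hatA0 ρ θ τ κ eθ pρ pθ u := by
  ext i j
  fin_cases i <;> fin_cases j <;>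
    simp [S, A0, hatA0, Matrix.mul_apply, Fin.sum_univ_four] <;> ring

theorem S_mul_A1 {ρ θ κ : ℝ} (τ eθ pρ pθ u : ℝ) (hρ : ρ ≠ 0) (hθ : θ ≠ 0) (hκ : κ ≠ 0) :
    S ρ θ τ κ eθ pρ pθ u * A1 ρ θ τ κ eθ pρ pθ u = hatA1 ρ θ τ κ eθ pρ pθ u := by
  ext i j
  fin_cases i <;> fin_cases j <;>
    simp [S, A1, hatA1, Matrix.mul_apply, Fin.sum_univ_four] <;> field_simp

theorem hatA1_isSymm (ρ θ τ κ eθ pρ pθ u : ℝ) : (hatA1 ρ θ τ κ eθ pρ pθ u).IsSymm := by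
  ext i j
  fin_cases i <;> fin_cases j <;> simp [hatA1]

theorem S_mul_Bmat (ρ θ τ κ eθ pρ pθ u ν : ℝ) : S ρ θ τ κ eθ pρ pθ u * Bmat ν = Bmat ν := by
  ext i j
  fin_cases i <;> fin_cases j <;> simp [S, Bmat, Matrix.mul_apply, Fin.sum_univ_four]

theorem S_mul_Dmat (ρ θ τ κ eθ pρ pθ u : ℝ) :
    S ρ θ τ κ eθ pρ pθ u * Dmat =
      !![0, 0, 0, 0; 0, 0, 0, 0; 0, 0, 0, 0; 0, 0, 0, -(1 / (κ * θ))] := by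
  ext i j
  fin_cases i <;> fin_cases j <;> simp [S, Dmat, Matrix.mul_apply, Fin.sum_univ_four]

theorem neg_S_mul_Dmat (ρ θ τ κ eθ pρ pθ u : ℝ) :
    -(S ρ θ τ κ eθ pρ pθ u * Dmat) =
      !![0, 0, 0, 0; 0, 0, 0, 0; 0, 0, 0, 0; 0, 0, 0, 1 / (κ * θ)] := by
  rw [S_mul_Dmat]
  ext i j
  fin_cases i <;> fin_cases j <;> simp

/-- `S` is a symmetrizer for the one-dimensional Cattaneo–Christov system: it is
symmetric and positive definite, the products `S A⁰`, `S A¹`, `S B`, `S D` are all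
symmetric, `S A⁰ = Â⁰` and `S A¹ = Â¹`, with `Â⁰` positive definite, `S B` positive
semidefinite, and `−S D = diag(0,0,0,1/(κθ))` positive semidefinite. -/
theorem cattaneo_christov_symmetrizable (ρ θ τ κ eθ pρ pθ u ν : ℝ)
    (hρ : 0 < ρ) (hθ : 0 < θ) (hτ : 0 < τ) (hκ : 0 < κ)
    (heθ : 0 < eθ) (hpρ : 0 < pρ) (hpθ : 0 < pθ) (hν : 0 ≤ ν) :
    (S ρ θ τ κ eθ pρ pθ u).IsSymm ∧ (S ρ θ τ κ eθ pρ pθ u).PosDef ∧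
    (S ρ θ τ κ eθ pρ pθ u * A0 ρ θ τ κ eθ pρ pθ u).IsSymm ∧
    (S ρ θ τ κ eθ pρ pθ u * A1 ρ θ τ κ eθ pρ pθ u).IsSymm ∧
    (S ρ θ τ κ eθ pρ pθ u * Bmat ν).IsSymm ∧
    (S ρ θ τ κ eθ pρ pθ u * Dmat).IsSymm ∧
    S ρ θ τ κ eθ pρ pθ u * A0 ρ θ τ κ eθ pρ pθ u = hatA0 ρ θ τ κ eθ pρ pθ u ∧
    S ρ θ τ κ eθ pρ pθ u * A1 ρ θ τ κ eθ pρ pθ u = hatA1 ρ θ τ κ eθ pρ pθ u ∧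
    (hatA0 ρ θ τ κ eθ pρ pθ u).PosDef ∧
    (S ρ θ τ κ eθ pρ pθ u * Bmat ν).PosSemidef ∧
    -(S ρ θ τ κ eθ pρ pθ u * Dmat) =
      !![0, 0, 0, 0; 0, 0, 0, 0; 0, 0, 0, 0; 0, 0, 0, 1 / (κ * θ)] ∧
    (-(S ρ θ τ κ eθ pρ pθ u * Dmat)).PosSemidef := by
  rw [neg_S_mul_Dmat, S_mul_Dmat, S_mul_Bmat, S_mul_A0, S_mul_A1 _ _ _ _ _ hρ.ne' hθ.ne' hκ.ne']
  exact ⟨isSymm_fin_four _ _ _ _,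
    posDef_fin_four (by positivity) one_pos (by positivity) (by positivity),
    isSymm_fin_four _ _ _ _, hatA1_isSymm _ _ _ _ _ _ _ _, isSymm_fin_four _ _ _ _,
    isSymm_fin_four _ _ _ _, rfl, rfl,
    posDef_fin_four (by positivity) hρ (by positivity) (by positivity),
    posSemidef_fin_four le_rfl hν le_rfl le_rfl, rfl,
    posSemidef_fin_four le_rfl le_rfl le_rfl (by positivity)⟩
end

section
/- Fix real parameters ρ > 0, θ > 0, τ > 0, κ > 0, e_θ > 0, p_ρ > 0, p_θ > 0, u ∈ ℝ, ν ≥ 0. Then the Cattaneo–Christov system satisfies the genuine coupling condition: for every V ∈ ℝ⁴ with V ≠ 0, B̂V = 0 and L̂V = 0, and for every λ ∈ ℝ, one has (λ Â⁰ + Â¹) V ≠ 0. -/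
/-- The symmetrized viscosity matrix `B̂ = diag(0, ν, 0, 0)`. -/
def hatB (ν : ℝ) : Matrix (Fin 4) (Fin 4) ℝ :=
  !![0, 0, 0, 0;
     0, ν, 0, 0;
     0, 0, 0, 0;
     0, 0, 0, 0]

/-- The symmetrized relaxation matrix `L̂ = diag(0, 0, 0, 1/(κθ))`. -/
noncomputable def hatL (θ κ : ℝ) : Matrix (Fin 4) (Fin 4) ℝ :=
  !![0, 0, 0, 0;
     0, 0, 0, 0;
     0, 0, 0, 0;
     0, 0, 0, 1 / (κ * θ)]

/-- Genuine coupling (Kawashima–Shizuta) condition for the one-dimensional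
Cattaneo–Christov system: no nonzero vector in `ker B̂ ∩ ker L̂` is an eigenvector of
the hyperbolic pencil, i.e. `(λ Â⁰ + Â¹)V ≠ 0` for all real `λ`. -/
theorem cattaneo_christov_genuine_coupling (ρ θ τ κ eθ pρ pθ u ν : ℝ)
    (hρ : 0 < ρ) (hθ : 0 < θ) (hτ : 0 < τ) (hκ : 0 < κ)
    (heθ : 0 < eθ) (hpρ : 0 < pρ) (hpθ : 0 < pθ) (hν : 0 ≤ ν) :
    ∀ V : Fin 4 → ℝ, V ≠ 0 → (hatB ν).mulVec V = 0 → (hatL θ κ).mulVec V = 0 →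
      ∀ lam : ℝ,
        (lam • hatA0 ρ θ τ κ eθ pρ pθ u + hatA1 ρ θ τ κ eθ pρ pθ u).mulVec V ≠ 0 := by
  intro V hV _ hL lam h
  have hq : V 3 = 0 := by
    have := congrFun hL 3
    simpa [hatL, Matrix.mulVec, dotProduct, Fin.sum_univ_four, hκ.ne', hθ.ne'] using this
  have hc : V 2 = 0 := by
    have := congrFun h 3
    simpa [hatA0, hatA1, Matrix.mulVec, dotProduct, Fin.sum_univ_four, hq, hθ.ne'] using this
  have hb : V 1 = 0 := by
    have := congrFun h 2
    simpa [hatA0, hatA1, Matrix.mulVec, dotProduct, Fin.sum_univ_four, hq, hc, hpθ.ne'] using this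
  have ha : V 0 = 0 := by
    have := congrFun h 1
    simpa [hatA0, hatA1, Matrix.mulVec, dotProduct, Fin.sum_univ_four, hb, hc, hq, hpρ.ne'] using this
  apply hV
  ext i
  fin_cases i <;> assumption
end

section
/- Fix real parameters ρ > 0, θ > 0, τ > 0, κ > 0, e_θ > 0, p_ρ > 0, p_θ > 0, u ∈ ℝ and ν > 0 (viscous case). Then there exist real numbers α, β, γ such that the matrix K := N (Â⁰)⁻¹, where N is the skew-symmetric 4×4 matrix with rows (0, α, 0, 0), (−α, 0, −β, 0), (0, β, 0, −γ), (0, 0, γ, 0), is a compensating function for the viscous Cattaneo–Christov system: K Â⁰ is skew-symmetric and (1/2)(K Â¹ + (K Â¹)ᵀ) + B̂ + L̂ is positive definite. -/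
open Matrix
/-- The skew-symmetric matrix `N` with parameters `α, β, γ`. -/
def Nmat (α β γ : ℝ) : Matrix (Fin 4) (Fin 4) ℝ :=
  !![0, α, 0, 0;
     -α, 0, -β, 0;
     0, β, 0, -γ;
     0, 0, γ, 0]

theorem binary_form_pos {a b c x y : ℝ} (ha : 0 < a) (h : b ^ 2 < a * c)
    (hxy : x ≠ 0 ∨ y ≠ 0) : 0 < a * x ^ 2 + 2 * b * (x * y) + c * y ^ 2 := by
  refine pos_of_mul_pos_right (a := a) ?_ ha.le
  have key : a * (a * x ^ 2 + 2 * b * (x * y) + c * y ^ 2)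
      = (a * x + b * y) ^ 2 + (a * c - b ^ 2) * y ^ 2 := by ring
  rw [key]
  by_cases hy : y = 0
  · have hx : x ≠ 0 := hxy.resolve_right (not_not_intro hy)
    subst hy
    simp only [mul_zero, add_zero, ne_eq, OfNat.ofNat_ne_zero, not_false_eq_true, zero_pow]
    positivity
  · have : 0 < (a * c - b ^ 2) * y ^ 2 := mul_pos (sub_pos.2 h) (by positivity)
    positivity

theorem posDef_of_two_interleaved_blocks {A B C D e f : ℝ} (hA : 0 < A) (hB : 0 < B)
    (he : e ^ 2 < A * C) (hf : f ^ 2 < B * D) :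
    (!![A, 0, e, 0; 0, B, 0, f; e, 0, C, 0; 0, f, 0, D] : Matrix (Fin 4) (Fin 4) ℝ).PosDef := by
  refine Matrix.PosDef.of_dotProduct_mulVec_pos ?_ fun x hx => ?_
  · ext i j
    fin_cases i <;> fin_cases j <;> rfl
  · have hsum : star x ⬝ᵥ
        ((!![A, 0, e, 0; 0, B, 0, f; e, 0, C, 0; 0, f, 0, D] : Matrix (Fin 4) (Fin 4) ℝ) *ᵥ x)
        = (A * x 0 ^ 2 + 2 * e * (x 0 * x 2) + C * x 2 ^ 2)
          + (B * x 1 ^ 2 + 2 * f * (x 1 * x 3) + D * x 3 ^ 2) := by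
      simp [dotProduct, mulVec, Fin.sum_univ_four]
      ring
    rw [hsum]
    by_cases h02 : x 0 ≠ 0 ∨ x 2 ≠ 0
    · have h₁ := binary_form_pos hA he h02
      by_cases h13 : x 1 ≠ 0 ∨ x 3 ≠ 0
      · exact add_pos h₁ (binary_form_pos hB hf h13)
      · push Not at h13
        simpa [h13.1, h13.2] using h₁
    · push Not at h02
      have h13 : x 1 ≠ 0 ∨ x 3 ≠ 0 := by
        by_contra! h
        apply hx
        ext i
        fin_cases i <;> simp [h02, h]
      simpa [h02.1, h02.2] using binary_form_pos hB hf h13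

theorem hatA0_inv {ρ θ τ κ eθ pρ : ℝ} (pθ u : ℝ) (hρ : ρ ≠ 0) (hθ : θ ≠ 0) (hτ : τ ≠ 0)
    (hκ : κ ≠ 0) (heθ : eθ ≠ 0) (hpρ : pρ ≠ 0) :
    (hatA0 ρ θ τ κ eθ pρ pθ u)⁻¹ =
      !![ρ / pρ, 0, 0, 0; 0, 1 / ρ, 0, 0; 0, 0, θ / (ρ * eθ), 0; 0, 0, 0, κ * θ / τ] := by
  refine Matrix.inv_eq_right_inv ?_
  ext i j
  fin_cases i <;> fin_cases j <;>
    simp [hatA0, Matrix.mul_apply, Fin.sum_univ_four] <;> field_simp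

/-- For `β = 0` the symmetrized matrix splits into a block in the first and third coordinates and
a block in the second and fourth coordinates. -/
theorem symmetrized_eq {ρ θ τ κ eθ pρ : ℝ} (pθ u ν α g : ℝ) (hρ : ρ ≠ 0) (hθ : θ ≠ 0)
    (hτ : τ ≠ 0) (hκ : κ ≠ 0) (heθ : eθ ≠ 0) (hpρ : pρ ≠ 0) :
    (1 / 2 : ℝ) •
          (Nmat α 0 (-g) * (hatA0 ρ θ τ κ eθ pρ pθ u)⁻¹ * hatA1 ρ θ τ κ eθ pρ pθ u
            + (Nmat α 0 (-g) * (hatA0 ρ θ τ κ eθ pρ pθ u)⁻¹ * hatA1 ρ θ τ κ eθ pρ pθ u)ᵀ)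
        + hatB ν + hatL θ κ =
      !![α * pρ / ρ, 0, α * pθ / (2 * ρ), 0;
         0, ν - α * ρ, 0, -(g * pθ * θ / (2 * (ρ * eθ)));
         α * pθ / (2 * ρ), 0, g * κ / τ, 0;
         0, -(g * pθ * θ / (2 * (ρ * eθ))), 0, 1 / (κ * θ) - g / (ρ * eθ)] := by
  rw [hatA0_inv pθ u hρ hθ hτ hκ heθ hpρ]
  ext i j
  fin_cases i <;> fin_cases j <;>
    simp [Nmat, hatA1, hatB, hatL] <;> field_simp <;> ring

theorem exists_pos_of_continuous {f : ℝ → ℝ} (hf : Continuous f) (h0 : 0 < f 0) :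
    ∃ t > 0, 0 < f t := by
  have h : ∀ᶠ t in nhdsWithin (0 : ℝ) (Set.Ioi 0), 0 < f t :=
    nhdsWithin_le_nhds (hf.continuousAt.eventually_const_lt h0)
  obtain ⟨t, hft, ht⟩ := (h.and eventually_mem_nhdsWithin).exists
  exact ⟨t, ht, hft⟩

/-- Existence of a compensating function for the viscous (`ν > 0`) one-dimensional
Cattaneo–Christov system: there are `α, β, γ` such that `K = N (Â⁰)⁻¹` satisfies that
`K Â⁰` is skew-symmetric and `(1/2)(K Â¹ + (K Â¹)ᵀ) + B̂ + L̂` is positive definite. -/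
theorem cattaneo_christov_compensating_function_viscous (ρ θ τ κ eθ pρ pθ u ν : ℝ)
    (hρ : 0 < ρ) (hθ : 0 < θ) (hτ : 0 < τ) (hκ : 0 < κ)
    (heθ : 0 < eθ) (hpρ : 0 < pρ) (hpθ : 0 < pθ) (hν : 0 < ν) :
    ∃ α β γ : ℝ,
      let K : Matrix (Fin 4) (Fin 4) ℝ := Nmat α β γ * (hatA0 ρ θ τ κ eθ pρ pθ u)⁻¹
      (K * hatA0 ρ θ τ κ eθ pρ pθ u)ᵀ = -(K * hatA0 ρ θ τ κ eθ pρ pθ u) ∧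
      ((1 / 2 : ℝ) •
          (K * hatA1 ρ θ τ κ eθ pρ pθ u + (K * hatA1 ρ θ τ κ eθ pρ pθ u)ᵀ)
        + hatB ν + hatL θ κ).PosDef := by
  obtain ⟨g, hg, hg'⟩ := exists_pos_of_continuous
    (f := fun g => ν / 2 * (1 / (κ * θ) - g / (ρ * eθ)) - (g * pθ * θ / (2 * (ρ * eθ))) ^ 2)
    (by fun_prop) (by simp only [zero_div, zero_mul, zero_pow two_ne_zero, sub_zero]; positivity)
  obtain ⟨α, hα, hα'⟩ := exists_pos_of_continuous
    (f := fun α => min (ν / 2 - α * ρ) (pρ * (g * κ / τ) - α * (pθ ^ 2 / (4 * ρ))))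
    (by fun_prop) (by simp only [zero_mul, sub_zero]; positivity)
  obtain ⟨hα₁, hα₂⟩ := lt_min_iff.1 hα'
  have hD : 0 < 1 / (κ * θ) - g / (ρ * eθ) := by
    refine pos_of_mul_pos_right (a := ν / 2) ?_ (by positivity)
    linarith [sq_nonneg (g * pθ * θ / (2 * (ρ * eθ)))]
  refine ⟨α, 0, -g, ?_, ?_⟩
  · have hdet : IsUnit (hatA0 ρ θ τ κ eθ pρ pθ u).det := by
      have hdiag : hatA0 ρ θ τ κ eθ pρ pθ u
          = Matrix.diagonal ![pρ / ρ, ρ, ρ * eθ / θ, τ / (κ * θ)] := by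
        ext i j
        fin_cases i <;> fin_cases j <;> simp [hatA0]
      rw [hdiag, Matrix.det_diagonal, isUnit_iff_ne_zero, Fin.prod_univ_four]
      simp only [Matrix.cons_val]
      positivity
    rw [Matrix.nonsing_inv_mul_cancel_right _ _ hdet]
    ext i j
    fin_cases i <;> fin_cases j <;> simp [Nmat]
  · rw [symmetrized_eq pθ u ν α g hρ.ne' hθ.ne' hτ.ne' hκ.ne' heθ.ne' hpρ.ne']
    refine posDef_of_two_interleaved_blocks (by positivity) (by linarith) ?_ ?_
    · have h := mul_pos (div_pos hα hρ) hα₂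
      have key : α * pρ / ρ * (g * κ / τ) - (α * pθ / (2 * ρ)) ^ 2
          = α / ρ * (pρ * (g * κ / τ) - α * (pθ ^ 2 / (4 * ρ))) := by
        field_simp
        ring
      linarith
    · rw [neg_sq]
      have := mul_pos hα₁ hD
      linarith
end

section
/- Fix real parameters ρ > 0, θ > 0, τ > 0, κ > 0, e_θ > 0, p_ρ > 0, p_θ > 0, u ∈ ℝ and ν = 0 (pure thermal relaxation case, so B̂ = 0). Then there exist real numbers α, β, γ such that the matrix K := N (Â⁰)⁻¹, where N is the skew-symmetric 4×4 matrix with rows (0, α, 0, 0), (−α, 0, −β, 0), (0, β, 0, −γ), (0, 0, γ, 0), is a compensating function for the inviscid Cattaneo–Christov system: K Â⁰ is skew-symmetric and (1/2)(K Â¹ + (K Â¹)ᵀ) + L̂ is positive definite. -/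
open Matrix
/-- A binary quadratic form with positive leading coefficient and negative discriminant is
positive away from the origin. -/
theorem binary_quadratic_form_pos {p q r x y : ℝ} (hp : 0 < p) (hd : q ^ 2 < 4 * p * r)
    (hxy : x ≠ 0 ∨ y ≠ 0) : 0 < p * x ^ 2 + q * (x * y) + r * y ^ 2 := by
  have key : 4 * p * (p * x ^ 2 + q * (x * y) + r * y ^ 2)
      = (2 * p * x + q * y) ^ 2 + (4 * p * r - q ^ 2) * y ^ 2 := by ring
  refine pos_of_mul_pos_right (a := 4 * p) ?_ (by positivity)
  rw [key]
  by_cases hy : y = 0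
  · have hx : x ≠ 0 := by simpa [hy] using hxy
    subst hy
    have : 2 * p * x ≠ 0 := by positivity
    simp only [mul_zero, add_zero]
    positivity
  · have : 0 < 4 * p * r - q ^ 2 := by linarith
    positivity

/-- A symmetric `4 × 4` matrix that couples only the coordinates `0, 2` and `1, 3` is positive
definite as soon as its two `2 × 2` blocks are. -/
theorem posDef_of_checkerboard {p q r p' q' r' : ℝ} (hp : 0 < p) (hd : q ^ 2 < 4 * p * r)
    (hp' : 0 < p') (hd' : q' ^ 2 < 4 * p' * r') :
    (!![p, 0, q / 2, 0;
        0, p', 0, q' / 2;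
        q / 2, 0, r, 0;
        0, q' / 2, 0, r'] : Matrix (Fin 4) (Fin 4) ℝ).PosDef := by
  refine Matrix.PosDef.of_dotProduct_mulVec_pos ?_ fun x hx => ?_
  · ext i j
    fin_cases i <;> fin_cases j <;> simp
  have nonneg {p q r : ℝ} (hp : 0 < p) (hd : q ^ 2 < 4 * p * r) (x y : ℝ) :
      0 ≤ p * x ^ 2 + q * (x * y) + r * y ^ 2 := by
    by_cases h : x ≠ 0 ∨ y ≠ 0
    · exact (binary_quadratic_form_pos hp hd h).le
    · push Not at h
      simp [h]
  have split : star x ⬝ᵥ (!![p, 0, q / 2, 0;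
        0, p', 0, q' / 2;
        q / 2, 0, r, 0;
        0, q' / 2, 0, r'] *ᵥ x)
      = (p * x 0 ^ 2 + q * (x 0 * x 2) + r * x 2 ^ 2)
        + (p' * x 1 ^ 2 + q' * (x 1 * x 3) + r' * x 3 ^ 2) := by
    simp [dotProduct, mulVec, Fin.sum_univ_four]
    ring
  rw [split]
  by_cases h : x 0 ≠ 0 ∨ x 2 ≠ 0
  · exact add_pos_of_pos_of_nonneg (binary_quadratic_form_pos hp hd h) (nonneg hp' hd' _ _)
  · refine add_pos_of_nonneg_of_pos (nonneg hp hd _ _) (binary_quadratic_form_pos hp' hd' ?_)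
    by_contra! h'
    push Not at h
    refine hx (funext fun i => ?_)
    fin_cases i
    exacts [h.1, h'.1, h.2, h'.2]

/-- The parameters of the compensating function, for a symmetrizer `diag(d₁, d₂, d₃, d₄)`, a
tridiagonal flux with off-diagonal entries `a, b, c` and relaxation rate `l`. -/
theorem exists_compensating_parameters {a b c d₁ d₂ d₃ d₄ l : ℝ} (ha : 0 < a) (hb : 0 < b)
    (hc : 0 < c) (hd₁ : 0 < d₁) (hd₂ : 0 < d₂) (hd₃ : 0 < d₃) (hd₄ : 0 < d₄) (hl : 0 < l) :
    ∃ α β γ : ℝ, 0 < α * a / d₂ ∧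
      ((α * b + β * a) / d₂) ^ 2 < 4 * (α * a / d₂) * (β * b / d₂ - γ * c / d₄) ∧
      0 < -(α * a / d₁) - β * b / d₃ ∧
      ((γ * b - β * c) / d₃) ^ 2 < 4 * (-(α * a / d₁) - β * b / d₃) * (γ * c / d₃ + l) := by
  obtain ⟨B, hB⟩ : ∃ B, B * b / d₃ = a / d₁ + 1 :=
    ⟨(a / d₁ + 1) * d₃ / b, by field_simp⟩
  have hBpos : 0 < B := by
    have : 0 < B * b / d₃ := by rw [hB]; positivity
    by_contra! hneg
    have : B * b / d₃ ≤ 0 :=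
      div_nonpos_of_nonpos_of_nonneg (mul_nonpos_of_nonpos_of_nonneg hneg hb.le) hd₃.le
    linarith
  set s := (b - B * a) / d₂ with hs
  obtain ⟨G, hGpos, hG⟩ : ∃ G, 0 < G ∧ G * c / d₄ = B * b / d₂ + s ^ 2 * d₂ / (4 * a) + 1 :=
    ⟨(B * b / d₂ + s ^ 2 * d₂ / (4 * a) + 1) * d₄ / c, by positivity, by field_simp⟩
  set t := (B * c - G * b) / d₃ with ht
  set g := G * c / d₃ with hg
  have hgpos : 0 < g := by positivity
  obtain ⟨ε, hε, hεl⟩ : ∃ ε, 0 < ε ∧ ε * (g + t ^ 2 + 1) = l :=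
    ⟨l / (g + t ^ 2 + 1), by positivity, by field_simp⟩
  have e₂ : -(ε * a / d₁) - -(ε * B) * b / d₃ = ε := by
    linear_combination ε * hB
  refine ⟨ε, -(ε * B), -(ε * G), by positivity, ?_, by rwa [e₂], ?_⟩
  · have e₁ : (ε * b + -(ε * B) * a) / d₂ = ε * s := by rw [hs]; ring
    have e₃ : -(ε * B) * b / d₂ - -(ε * G) * c / d₄ = ε * (s ^ 2 * d₂ / (4 * a) + 1) := by
      linear_combination ε * hG
    have e₄ : 4 * (ε * a / d₂) * (ε * (s ^ 2 * d₂ / (4 * a) + 1))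
        = (ε * s) ^ 2 + 4 * ε ^ 2 * a / d₂ := by
      field_simp
    rw [e₁, e₃, e₄]
    exact lt_add_of_pos_right _ (by positivity)
  · have e₁ : (-(ε * G) * b - -(ε * B) * c) / d₃ = ε * t := by rw [ht]; ring
    have e₃ : -(ε * G) * c / d₃ + l = ε * (t ^ 2 + 1) := by
      rw [← hεl, hg]; ring
    rw [e₂, e₁, e₃]
    have : 0 < ε ^ 2 * (3 * t ^ 2 + 4) := by positivity
    linarith

theorem hatA0_mul_inverse {ρ θ τ κ eθ pρ pθ u : ℝ} (hρ : 0 < ρ) (hθ : 0 < θ) (hτ : 0 < τ)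
    (hκ : 0 < κ) (heθ : 0 < eθ) (hpρ : 0 < pρ) :
    hatA0 ρ θ τ κ eθ pρ pθ u *
      diagonal ![(pρ / ρ)⁻¹, ρ⁻¹, (ρ * eθ / θ)⁻¹, (τ / (κ * θ))⁻¹] = 1 := by
  have h₁ : pρ / ρ ≠ 0 := by positivity
  have h₂ : ρ * eθ / θ ≠ 0 := by positivity
  have h₃ : τ / (κ * θ) ≠ 0 := by positivity
  ext i j
  rw [mul_diagonal]
  fin_cases i <;> fin_cases j <;>
    simp [hatA0, -div_eq_zero_iff, -inv_div, h₁, h₂, h₃, hρ.ne']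

/-- Existence of a compensating function for the inviscid (`ν = 0`) one-dimensional
Cattaneo–Christov system: there are `α, β, γ` such that `K = N (Â⁰)⁻¹` satisfies that
`K Â⁰` is skew-symmetric and `(1/2)(K Â¹ + (K Â¹)ᵀ) + L̂` is positive definite. -/
theorem cattaneo_christov_compensating_function_inviscid (ρ θ τ κ eθ pρ pθ u ν : ℝ)
    (hρ : 0 < ρ) (hθ : 0 < θ) (hτ : 0 < τ) (hκ : 0 < κ)
    (heθ : 0 < eθ) (hpρ : 0 < pρ) (hpθ : 0 < pθ) (hν : ν = 0) :
    ∃ α β γ : ℝ,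
      let K : Matrix (Fin 4) (Fin 4) ℝ := Nmat α β γ * (hatA0 ρ θ τ κ eθ pρ pθ u)⁻¹
      (K * hatA0 ρ θ τ κ eθ pρ pθ u)ᵀ = -(K * hatA0 ρ θ τ κ eθ pρ pθ u) ∧
      ((1 / 2 : ℝ) •
          (K * hatA1 ρ θ τ κ eθ pρ pθ u + (K * hatA1 ρ θ τ κ eθ pρ pθ u)ᵀ)
        + hatL θ κ).PosDef := by
  have hinv := hatA0_mul_inverse (pθ := pθ) (u := u) hρ hθ hτ hκ heθ hpρ
  have hdet : IsUnit (hatA0 ρ θ τ κ eθ pρ pθ u).det :=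
    (Matrix.isUnit_iff_isUnit_det _).1 (IsUnit.of_mul_eq_one _ hinv)
  obtain ⟨α, β, γ, hp, hd, hp', hd'⟩ := exists_compensating_parameters hpρ hpθ
    (one_div_pos.2 hθ) (div_pos hpρ hρ) hρ (div_pos (mul_pos hρ heθ) hθ)
    (div_pos hτ (mul_pos hκ hθ)) (one_div_pos.2 (mul_pos hκ hθ))
  refine ⟨α, β, γ, ?_, ?_⟩
  · rw [Matrix.nonsing_inv_mul_cancel_right _ _ hdet]
    ext i j
    fin_cases i <;> fin_cases j <;> simp [Nmat]
  · convert posDef_of_checkerboard hp hd hp' hd' using 1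
    rw [Matrix.inv_eq_right_inv hinv]
    ext i j
    simp only [Matrix.add_apply, Matrix.smul_apply, transpose_apply,
      mul_apply (N := hatA1 _ _ _ _ _ _ _ _), mul_diagonal, Fin.sum_univ_four]
    fin_cases i <;> fin_cases j <;>
      simp [Nmat, hatA1, hatL] <;> field_simp <;> ring
end

section
/- Let n ≥ 1 and let A⁰, A¹, B, L be real symmetric n×n matrices with A⁰ positive definite and B, L positive semidefinite. Suppose there exists a compensating function K, i.e., a real n×n matrix K such that KA⁰ is skew-symmetric and (1/2)(KA¹ + (KA¹)ᵀ) + B + L is positive definite. Then there exists a constant k > 0 such that for every ξ ∈ ℝ with ξ ≠ 0 and every λ ∈ ℂ satisfying the dispersion relation det(λA⁰ + iξA¹ + L + ξ²B) = 0, one has Re λ ≤ −k ξ²/(1 + ξ²). In particular the system is strictly dissipative: Re λ < 0 for all ξ ≠ 0. -/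
open Matrix

section QuadraticFormBounds

variable {ι : Type*} [Fintype ι]

lemma abs_dotProduct_mulVec_le (M : Matrix ι ι ℝ) :
    ∃ C : ℝ, 0 < C ∧ ∀ x y : ι → ℝ, |x ⬝ᵥ M *ᵥ y| ≤ C * (x ⬝ᵥ x + y ⬝ᵥ y) := by
  refine ⟨∑ i, ∑ j, |M i j| + 1, by positivity, fun x y => ?_⟩
  have hsq (z : ι → ℝ) (i : ι) : z i ^ 2 ≤ z ⬝ᵥ z := by
    rw [sq]
    exact Finset.single_le_sum (f := fun i => z i * z i) (fun i _ => mul_self_nonneg _)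
      (Finset.mem_univ i)
  have hnn (z : ι → ℝ) : 0 ≤ z ⬝ᵥ z := Finset.sum_nonneg fun i _ => mul_self_nonneg _
  have hterm (i j : ι) : |x i * (M i j * y j)| ≤ |M i j| * (x ⬝ᵥ x + y ⬝ᵥ y) := by
    rw [show x i * (M i j * y j) = M i j * (x i * y j) by ring, abs_mul]
    refine mul_le_mul_of_nonneg_left ?_ (abs_nonneg _)
    have hx := hsq x i
    have hy := hsq y j
    rw [abs_le]
    constructor <;> nlinarith [sq_nonneg (x i + y j), sq_nonneg (x i - y j)]
  calc |x ⬝ᵥ M *ᵥ y| = |∑ i, ∑ j, x i * (M i j * y j)| := by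
        simp only [dotProduct, mulVec, Finset.mul_sum]
    _ ≤ ∑ i, ∑ j, |M i j| * (x ⬝ᵥ x + y ⬝ᵥ y) :=
        (Finset.abs_sum_le_sum_abs _ _).trans <| Finset.sum_le_sum fun i _ =>
          (Finset.abs_sum_le_sum_abs _ _).trans <| Finset.sum_le_sum fun j _ => hterm i j
    _ = (∑ i, ∑ j, |M i j|) * (x ⬝ᵥ x + y ⬝ᵥ y) := by simp only [Finset.sum_mul]
    _ ≤ (∑ i, ∑ j, |M i j| + 1) * (x ⬝ᵥ x + y ⬝ᵥ y) := by
        nlinarith [hnn x, hnn y]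

lemma Matrix.IsSymm.dotProduct_mulVec_comm {P : Matrix ι ι ℝ} (hP : P.IsSymm) (x y : ι → ℝ) :
    x ⬝ᵥ P *ᵥ y = y ⬝ᵥ P *ᵥ x := by
  rw [dotProduct_mulVec, ← mulVec_transpose, hP.eq, dotProduct_comm]

lemma Matrix.PosSemidef.real_dotProduct_mulVec_nonneg {P : Matrix ι ι ℝ} (hP : P.PosSemidef)
    (x : ι → ℝ) : 0 ≤ x ⬝ᵥ P *ᵥ x := by
  simpa using hP.dotProduct_mulVec_nonneg x

lemma Matrix.PosSemidef.two_mul_dotProduct_mulVec_le {P : Matrix ι ι ℝ} (hP : P.PosSemidef)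
    (x y : ι → ℝ) : 2 * (x ⬝ᵥ P *ᵥ y) ≤ x ⬝ᵥ P *ᵥ x + y ⬝ᵥ P *ᵥ y := by
  have hs : P.IsSymm := by simpa [IsSymm, IsHermitian] using hP.isHermitian
  have h := hP.real_dotProduct_mulVec_nonneg (x - y)
  simp only [mulVec_sub, dotProduct_sub, sub_dotProduct] at h
  linarith [hs.dotProduct_mulVec_comm x y]

lemma Matrix.PosDef.exists_mul_dotProduct_self_le [DecidableEq ι] {P : Matrix ι ι ℝ}
    (hP : P.PosDef) : ∃ c : ℝ, 0 < c ∧ ∀ x : ι → ℝ, c * (x ⬝ᵥ x) ≤ x ⬝ᵥ P *ᵥ x := by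
  obtain ⟨C, hC, hbound⟩ := abs_dotProduct_mulVec_le P⁻¹
  have hdet : IsUnit P.det := (isUnit_iff_isUnit_det P).mp hP.isUnit
  have hs : P.IsSymm := by simpa [IsSymm, IsHermitian] using hP.isHermitian
  refine ⟨1 / (2 * C), by positivity, fun x => ?_⟩
  have h := hP.posSemidef.two_mul_dotProduct_mulVec_le ((1 / (2 * C)) • P⁻¹ *ᵥ x) x
  rw [hs.dotProduct_mulVec_comm _ x] at h
  simp only [mulVec_smul, mulVec_mulVec, mul_nonsing_inv P hdet, one_mulVec, smul_dotProduct,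
    dotProduct_smul, smul_eq_mul, dotProduct_comm (P⁻¹ *ᵥ x) x] at h
  have h' := mul_le_mul_of_nonneg_left ((le_abs_self _).trans (hbound x x))
    (by positivity : 0 ≤ 1 / (2 * C) * (1 / (2 * C)))
  have e : 1 / (2 * C) * (1 / (2 * C)) * (C * (x ⬝ᵥ x + x ⬝ᵥ x)) =
      1 / (2 * C) * (x ⬝ᵥ x) := by
    field_simp
    ring
  linarith

lemma Matrix.PosSemidef.two_mul_dotProduct_mul_mulVec_le {P : Matrix ι ι ℝ}
    (hP : P.PosSemidef) (K : Matrix ι ι ℝ) :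
    ∃ C : ℝ, 0 < C ∧ ∀ (r s : ℝ) (x y : ι → ℝ),
      2 * (r * s) * (x ⬝ᵥ (K * P) *ᵥ y) ≤ r ^ 2 * C * (x ⬝ᵥ x) + s ^ 2 * (y ⬝ᵥ P *ᵥ y) := by
  obtain ⟨C, hC, hbound⟩ := abs_dotProduct_mulVec_le (K * P * Kᵀ)
  have move (x z : ι → ℝ) : Kᵀ *ᵥ x ⬝ᵥ z = x ⬝ᵥ K *ᵥ z := by
    rw [dotProduct_mulVec, ← mulVec_transpose]
  refine ⟨2 * C, by positivity, fun r s x y => ?_⟩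
  have h := hP.two_mul_dotProduct_mulVec_le (r • Kᵀ *ᵥ x) (s • y)
  simp only [mulVec_smul, smul_dotProduct, dotProduct_smul, smul_eq_mul, move, mulVec_mulVec] at h
  rw [← Matrix.mul_assoc] at h
  have h' := mul_le_mul_of_nonneg_left ((le_abs_self _).trans (hbound x x)) (sq_nonneg r)
  linarith

end QuadraticFormBounds

section ComplexKernel

variable {n : ℕ}

/-- Splitting a complex null vector of the dispersion matrix into its real and imaginary parts. -/
lemma exists_real_imag_null_vector (A0 A1 B L : Matrix (Fin n) (Fin n) ℝ) (ξ : ℝ) (lam : ℂ)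
    (hdet : (lam • A0.map (Complex.ofReal) + (Complex.I * ξ) • A1.map (Complex.ofReal)
        + L.map (Complex.ofReal) + ((ξ : ℂ) ^ 2) • B.map (Complex.ofReal)).det = 0) :
    ∃ x y : Fin n → ℝ, (x ≠ 0 ∨ y ≠ 0) ∧
      lam.re • A0 *ᵥ x - lam.im • A0 *ᵥ y - ξ • A1 *ᵥ y + L *ᵥ x + ξ ^ 2 • B *ᵥ x = 0 ∧
      lam.re • A0 *ᵥ y + lam.im • A0 *ᵥ x + ξ • A1 *ᵥ x + L *ᵥ y + ξ ^ 2 • B *ᵥ y = 0 := by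
  obtain ⟨v, hv, h⟩ := exists_mulVec_eq_zero_iff.mpr hdet
  have hre (M : Matrix (Fin n) (Fin n) ℝ) (i : Fin n) :
      ((M.map Complex.ofReal *ᵥ v) i).re = (M *ᵥ fun j => (v j).re) i := by
    simp [mulVec, dotProduct]
  have him (M : Matrix (Fin n) (Fin n) ℝ) (i : Fin n) :
      ((M.map Complex.ofReal *ᵥ v) i).im = (M *ᵥ fun j => (v j).im) i := by
    simp [mulVec, dotProduct]
  have hsq : (ξ : ℂ) ^ 2 = ((ξ ^ 2 : ℝ) : ℂ) := by push_cast; rfl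
  rw [hsq] at h
  refine ⟨fun j => (v j).re, fun j => (v j).im, ?_, ?_, ?_⟩
  · by_contra! hxy
    exact hv <| funext fun j => Complex.ext (congrFun hxy.1 j) (congrFun hxy.2 j)
  · ext i
    have hi := congrArg Complex.re (congrFun h i)
    simp only [add_mulVec, smul_mulVec, Pi.add_apply, Pi.smul_apply, smul_eq_mul, Complex.add_re,
      Complex.mul_re, Complex.mul_im, hre, him, Complex.I_re, Complex.I_im, Complex.ofReal_re,
      Complex.ofReal_im, Pi.zero_apply, Complex.zero_re] at hi
    simp only [Pi.add_apply, Pi.sub_apply, Pi.smul_apply, smul_eq_mul, Pi.zero_apply]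
    linarith
  · ext i
    have hi := congrArg Complex.im (congrFun h i)
    simp only [add_mulVec, smul_mulVec, Pi.add_apply, Pi.smul_apply, smul_eq_mul, Complex.add_im,
      Complex.mul_re, Complex.mul_im, hre, him, Complex.I_re, Complex.I_im, Complex.ofReal_re,
      Complex.ofReal_im, Pi.zero_apply, Complex.zero_im] at hi
    simp only [Pi.add_apply, Pi.smul_apply, smul_eq_mul, Pi.zero_apply]
    linarith

end ComplexKernel

/-- The scalar inequality behind the decay rate: `l`, `b`, `a0`, `V` stand for the quadratic forms of
`L`, `B`, `A⁰`, `1`, and `s`, `q`, `p`, `r` for those of the products with the compensating matrix. -/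
lemma decay_of_energy_estimates {a a0 b c d e l p q r s C0 C1 CB CL M V σ ξ : ℝ}
    (ha : 0 < a) (hC1 : 0 < C1) (he : 0 < e) (hed : 2 * d * e = 1)
    (hdc : d * (CL + CB) = c) (hM : M = 1 + C1 / a + e) (hMpos : 0 < M) (hV : 0 < V)
    (hl : 0 ≤ l) (hb : 0 ≤ b)
    (energy : σ * a0 + l + ξ ^ 2 * b = 0)
    (comp : 2 * σ * s + ξ * q + p + ξ ^ 2 * r = 0)
    (coer : c * V ≤ q + b + l)
    (hp : -(2 * d * ξ * p) ≤ (d * ξ) ^ 2 * CL * V + l)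
    (hr : -(2 * d * ξ * r) ≤ d ^ 2 * CB * V + ξ ^ 2 * b)
    (ha0 : a * V ≤ a0) (ha0' : a0 ≤ 2 * C0 * V) (hs : |s| ≤ C1 * V) :
    c / 2 * ξ ^ 2 ≤ (1 + ξ ^ 2) * M * (2 * C0) * -σ := by
  have ha0pos : 0 < a0 := (mul_pos ha hV).trans_le ha0
  have hξb : 0 ≤ ξ ^ 2 * b := by positivity
  have hσ : 0 ≤ -σ := by
    by_contra! h
    have := mul_pos (by linarith : 0 < σ) ha0pos
    linarith
  have hp' : -(ξ * p) ≤ d / 2 * ξ ^ 2 * CL * V + e * l := by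
    have h := mul_le_mul_of_nonneg_left hp he.le
    linear_combination h + (ξ * p + d * ξ ^ 2 * CL * V / 2) * hed
  have hr' : -(ξ ^ 3 * r) ≤ d / 2 * ξ ^ 2 * CB * V + e * ξ ^ 4 * b := by
    have h := mul_le_mul_of_nonneg_left hr (by positivity : 0 ≤ e * ξ ^ 2)
    linear_combination h + (ξ ^ 3 * r + d * ξ ^ 2 * CB * V / 2) * hed
  have hσs : |σ * s| ≤ C1 / a * (l + ξ ^ 2 * b) := by
    have hVa : C1 * V ≤ C1 / a * a0 := by
      rw [div_mul_eq_mul_div, le_div_iff₀ ha]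
      linarith [mul_le_mul_of_nonneg_left ha0 hC1.le]
    rw [abs_mul, abs_of_nonpos (by linarith : σ ≤ 0)]
    have h := mul_le_mul_of_nonneg_left (hs.trans hVa) hσ
    linear_combination h - C1 / a * energy
  have hξσs : -(2 * ξ * (σ * s)) ≤ (1 + ξ ^ 2) * (C1 / a * (l + ξ ^ 2 * b)) := by
    calc -(2 * ξ * (σ * s)) ≤ |2 * ξ * (σ * s)| := neg_le_abs _
      _ = |2 * ξ| * |σ * s| := abs_mul _ _
      _ ≤ (1 + ξ ^ 2) * (C1 / a * (l + ξ ^ 2 * b)) := by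
        refine mul_le_mul ?_ hσs (abs_nonneg _) (by positivity)
        rw [abs_le]
        constructor <;> nlinarith [sq_nonneg (ξ + 1), sq_nonneg (ξ - 1)]
  have main : c / 2 * ξ ^ 2 * V ≤ (1 + ξ ^ 2) * M * (l + ξ ^ 2 * b) := by
    have h := mul_le_mul_of_nonneg_left coer (sq_nonneg ξ)
    have hel : 0 ≤ e * ξ ^ 2 * l := by positivity
    have heb : 0 ≤ e * ξ ^ 2 * b := by positivity
    have hξ4 : 0 ≤ ξ ^ 4 * b := by positivity
    subst hM
    linear_combination h + hp' + hr' + hξσs + hel + heb + hξ4 + hl + ξ * comp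
      + ξ ^ 2 * V / 2 * hdc
  have upper : l + ξ ^ 2 * b ≤ 2 * C0 * V * -σ := by
    linarith [mul_le_mul_of_nonneg_left ha0' hσ]
  have h := mul_le_mul_of_nonneg_left upper (by positivity : 0 ≤ (1 + ξ ^ 2) * M)
  refine le_of_mul_le_mul_right ?_ hV
  linarith

/-- Existence of a compensating function implies strict dissipativity with the
Kawashima decay rate: every root `λ` of the dispersion relation
`det(λA⁰ + iξA¹ + L + ξ²B) = 0` with `ξ ≠ 0` satisfies
`Re λ ≤ −kξ²/(1+ξ²) < 0` for a uniform constant `k > 0`. -/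
theorem compensating_implies_strict_dissipativity (n : ℕ) (hn : 1 ≤ n)
    (A0 A1 B L : Matrix (Fin n) (Fin n) ℝ)
    (hA0s : A0.IsSymm) (hA1s : A1.IsSymm) (hBs : B.IsSymm) (hLs : L.IsSymm)
    (hA0 : A0.PosDef) (hB : B.PosSemidef) (hL : L.PosSemidef)
    (K : Matrix (Fin n) (Fin n) ℝ)
    (hK1 : (K * A0)ᵀ = -(K * A0))
    (hK2 : ((1 / 2 : ℝ) • (K * A1 + (K * A1)ᵀ) + B + L).PosDef) :
    ∃ k : ℝ, 0 < k ∧ ∀ ξ : ℝ, ξ ≠ 0 → ∀ lam : ℂ,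
      (lam • A0.map (Complex.ofReal) + (Complex.I * ξ) • A1.map (Complex.ofReal)
        + L.map (Complex.ofReal) + ((ξ : ℂ) ^ 2) • B.map (Complex.ofReal)).det = 0 →
      lam.re ≤ -(k * ξ ^ 2 / (1 + ξ ^ 2)) ∧ lam.re < 0 := by
  obtain ⟨c, hc, hcoer⟩ := hK2.exists_mul_dotProduct_self_le
  obtain ⟨a, ha, hA0coer⟩ := hA0.exists_mul_dotProduct_self_le
  obtain ⟨C0, hC0, hA0bd⟩ := abs_dotProduct_mulVec_le A0
  obtain ⟨C1, hC1, hKA0bd⟩ := abs_dotProduct_mulVec_le (K * A0)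
  obtain ⟨CL, hCL, hKL⟩ := hL.two_mul_dotProduct_mul_mulVec_le K
  obtain ⟨CB, hCB, hKB⟩ := hB.two_mul_dotProduct_mul_mulVec_le K
  obtain ⟨d, hd, hdc⟩ : ∃ d : ℝ, 0 < d ∧ d * (CL + CB) = c :=
    ⟨c / (CL + CB), by positivity, by field_simp⟩
  obtain ⟨e, he, hed⟩ : ∃ e : ℝ, 0 < e ∧ 2 * d * e = 1 :=
    ⟨1 / (2 * d), by positivity, by field_simp⟩
  -- `M` bounds the constant in `(c / 2) ξ² |v|² ≤ M (1 + ξ²) ⟨v, (L + ξ² B) v⟩`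
  obtain ⟨M, hM⟩ : ∃ M : ℝ, M = 1 + C1 / a + e := ⟨_, rfl⟩
  have hMpos : 0 < M := by rw [hM]; positivity
  refine ⟨c / (4 * M * C0), by positivity, fun ξ hξ lam hdet => ?_⟩
  obtain ⟨x, y, hxy, h1, h2⟩ := exists_real_imag_null_vector A0 A1 B L ξ lam hdet
  have hnn (z : Fin n → ℝ) : 0 ≤ z ⬝ᵥ z := Finset.sum_nonneg fun i _ => mul_self_nonneg _
  have hV : 0 < x ⬝ᵥ x + y ⬝ᵥ y := by
    rcases hxy with hx | hy
    · have := (hnn x).lt_of_ne' (mt dotProduct_self_eq_zero.mp hx)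
      linarith [hnn y]
    · have := (hnn y).lt_of_ne' (mt dotProduct_self_eq_zero.mp hy)
      linarith [hnn x]
  have skew (u w : Fin n → ℝ) : u ⬝ᵥ (K * A0) *ᵥ w = -(w ⬝ᵥ (K * A0) *ᵥ u) := by
    rw [dotProduct_mulVec, ← mulVec_transpose, hK1, neg_mulVec, neg_dotProduct, dotProduct_comm]
  have energy : lam.re * (x ⬝ᵥ A0 *ᵥ x + y ⬝ᵥ A0 *ᵥ y) +
      (x ⬝ᵥ L *ᵥ x + y ⬝ᵥ L *ᵥ y) + ξ ^ 2 * (x ⬝ᵥ B *ᵥ x + y ⬝ᵥ B *ᵥ y) = 0 := by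
    have e1 := congrArg (x ⬝ᵥ ·) h1
    have e2 := congrArg (y ⬝ᵥ ·) h2
    simp only [dotProduct_add, dotProduct_sub, dotProduct_smul, smul_eq_mul, dotProduct_zero]
      at e1 e2
    rw [hA0s.dotProduct_mulVec_comm y x, hA1s.dotProduct_mulVec_comm y x] at e2
    linarith
  have comp : 2 * lam.re * (x ⬝ᵥ (K * A0) *ᵥ y) +
      ξ * (x ⬝ᵥ (K * A1) *ᵥ x + y ⬝ᵥ (K * A1) *ᵥ y) +
      (x ⬝ᵥ (K * L) *ᵥ y - y ⬝ᵥ (K * L) *ᵥ x) +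
      ξ ^ 2 * (x ⬝ᵥ (K * B) *ᵥ y - y ⬝ᵥ (K * B) *ᵥ x) = 0 := by
    have e1 := congrArg (fun w => y ⬝ᵥ K *ᵥ w) h1
    have e2 := congrArg (fun w => x ⬝ᵥ K *ᵥ w) h2
    simp only [mulVec_add, mulVec_sub, mulVec_smul, mulVec_mulVec, dotProduct_add,
      dotProduct_sub, dotProduct_smul, smul_eq_mul, mulVec_zero, dotProduct_zero] at e1 e2
    have hx0 : x ⬝ᵥ (K * A0) *ᵥ x = 0 := by linarith [skew x x]
    have hy0 : y ⬝ᵥ (K * A0) *ᵥ y = 0 := by linarith [skew y y]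
    rw [skew y x, hy0] at e1
    rw [hx0] at e2
    linarith
  have coer (z : Fin n → ℝ) :
      c * (z ⬝ᵥ z) ≤ z ⬝ᵥ (K * A1) *ᵥ z + z ⬝ᵥ B *ᵥ z + z ⬝ᵥ L *ᵥ z := by
    have h := hcoer z
    have ht : z ⬝ᵥ (K * A1)ᵀ *ᵥ z = z ⬝ᵥ (K * A1) *ᵥ z := by
      rw [mulVec_transpose, dotProduct_comm, ← dotProduct_mulVec]
    simp only [add_mulVec, smul_mulVec, dotProduct_add, dotProduct_smul, smul_eq_mul, ht] at h
    linarith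
  have hcx := coer x
  have hcy := coer y
  have hlx := hL.real_dotProduct_mulVec_nonneg x
  have hly := hL.real_dotProduct_mulVec_nonneg y
  have hbx := hB.real_dotProduct_mulVec_nonneg x
  have hby := hB.real_dotProduct_mulVec_nonneg y
  have hL1 := hKL (d * ξ) (-1) x y
  have hL2 := hKL (d * ξ) 1 y x
  have hB1 := hKB d (-ξ) x y
  have hB2 := hKB d ξ y x
  have ha0x := hA0coer x
  have ha0y := hA0coer y
  have hCx := (le_abs_self _).trans (hA0bd x x)
  have hCy := (le_abs_self _).trans (hA0bd y y)
  have hs := hKA0bd x y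
  have hdecay : c / 2 * ξ ^ 2 ≤ (1 + ξ ^ 2) * M * (2 * C0) * -lam.re := by
    refine decay_of_energy_estimates (a0 := x ⬝ᵥ A0 *ᵥ x + y ⬝ᵥ A0 *ᵥ y)
      (l := x ⬝ᵥ L *ᵥ x + y ⬝ᵥ L *ᵥ y) (b := x ⬝ᵥ B *ᵥ x + y ⬝ᵥ B *ᵥ y)
      (V := x ⬝ᵥ x + y ⬝ᵥ y) (s := x ⬝ᵥ (K * A0) *ᵥ y)
      (q := x ⬝ᵥ (K * A1) *ᵥ x + y ⬝ᵥ (K * A1) *ᵥ y)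
      (p := x ⬝ᵥ (K * L) *ᵥ y - y ⬝ᵥ (K * L) *ᵥ x)
      (r := x ⬝ᵥ (K * B) *ᵥ y - y ⬝ᵥ (K * B) *ᵥ x)
      ha hC1 he hed hdc hM hMpos hV (by linarith) (by linarith) energy comp
      (by linarith) (by linarith) (by linarith) (by linarith) (by linarith) hs
  have hξ2 : 0 < ξ ^ 2 := by positivity
  have hle : lam.re ≤ -(c / (4 * M * C0) * ξ ^ 2 / (1 + ξ ^ 2)) := by
    have : c / (4 * M * C0) * ξ ^ 2 / (1 + ξ ^ 2) =
        c / 2 * ξ ^ 2 / ((1 + ξ ^ 2) * M * (2 * C0)) := by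
      field_simp
      ring
    rw [this, le_neg, div_le_iff₀ (by positivity)]
    linarith
  have hpos : 0 < c / (4 * M * C0) * ξ ^ 2 / (1 + ξ ^ 2) := by positivity
  exact ⟨hle, by linarith⟩
end

section
/- Let n ≥ 1 and let A⁰, A¹, B, L be real symmetric n×n matrices with A⁰ positive definite and B, L positive semidefinite. Suppose the genuine coupling condition fails, i.e., there exist V ∈ ℝⁿ with V ≠ 0, BV = 0, LV = 0, and μ ∈ ℝ such that (μA⁰ + A¹)V = 0. Then for every ξ ∈ ℝ the complex number λ := i μ ξ satisfies the dispersion relation det(λA⁰ + iξA¹ + L + ξ²B) = 0 and has Re λ = 0; in particular the system is not strictly dissipative. -/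
open Matrix

theorem map_ofReal_mulVec {m n : Type*} [Fintype n] (M : Matrix m n ℝ) (v : n → ℝ) :
    M.map Complex.ofReal *ᵥ (fun i => (v i : ℂ)) = fun i => ((M *ᵥ v) i : ℂ) := by
  ext i
  simp [Matrix.mulVec, dotProduct]

/-- Failure of the genuine coupling condition implies failure of strict dissipativity:
if a nonzero `V ∈ ker B ∩ ker L` satisfies `(μA⁰ + A¹)V = 0` for some real `μ`, then
for every `ξ ∈ ℝ` the purely imaginary number `λ = iμξ` (with `Re λ = 0`) solves the
dispersion relation `det(λA⁰ + iξA¹ + L + ξ²B) = 0`. -/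
theorem no_genuine_coupling_implies_not_strictly_dissipative (n : ℕ) (hn : 1 ≤ n)
    (A0 A1 B L : Matrix (Fin n) (Fin n) ℝ)
    (hA0s : A0.IsSymm) (hA1s : A1.IsSymm) (hBs : B.IsSymm) (hLs : L.IsSymm)
    (hA0 : A0.PosDef) (hB : B.PosSemidef) (hL : L.PosSemidef)
    (V : Fin n → ℝ) (hV : V ≠ 0) (hBV : B.mulVec V = 0) (hLV : L.mulVec V = 0)
    (μ : ℝ) (hμ : (μ • A0 + A1).mulVec V = 0) :
    ∀ ξ : ℝ,
      ((Complex.I * μ * ξ) • A0.map (Complex.ofReal)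
          + (Complex.I * ξ) • A1.map (Complex.ofReal)
          + L.map (Complex.ofReal) + ((ξ : ℂ) ^ 2) • B.map (Complex.ofReal)).det = 0 ∧
      (Complex.I * μ * ξ).re = 0 := by
  intro ξ
  refine ⟨?_, by simp⟩
  refine Matrix.exists_mulVec_eq_zero_iff.mp ⟨fun i => (V i : ℂ), fun h => hV ?_, ?_⟩
  · ext i
    simpa using congrFun h i
  · ext i
    have hi : (μ : ℂ) * ((A0 *ᵥ V) i : ℂ) + ((A1 *ᵥ V) i : ℂ) = 0 := by
      have := congrFun hμ i
      simp only [add_mulVec, smul_mulVec, Pi.add_apply, Pi.smul_apply, smul_eq_mul,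
        Pi.zero_apply] at this
      exact_mod_cast this
    simp only [add_mulVec, smul_mulVec, map_ofReal_mulVec, hBV, hLV, Pi.add_apply,
      Pi.smul_apply, smul_eq_mul, Pi.zero_apply, Complex.ofReal_zero]
    linear_combination Complex.I * ξ * hi
end

section
/- Let n ≥ 1 and let A⁰, A¹, B, L be real symmetric n×n matrices with A⁰ positive definite and B, L positive semidefinite, and suppose there exists a compensating function K (KA⁰ skew-symmetric and (1/2)(KA¹ + (KA¹)ᵀ) + B + L positive definite). Then there exist constants C > 0 and k > 0, depending only on the matrices, such that for every ξ ∈ ℝ and every differentiable function Û : [0,∞) → ℂⁿ satisfying A⁰ Û'(t) + iξ A¹ Û(t) + L Û(t) + ξ² B Û(t) = 0 for all t ≥ 0, one has |Û(t)| ≤ C |Û(0)| exp(−k ξ² t/(1 + ξ²)) for all t ≥ 0. -/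
open Matrix

section HilbertSpace

open scoped InnerProductSpace

variable {H : Type*} [NormedAddCommGroup H] [InnerProductSpace ℂ H]

/-- A bounded positive operator `T` satisfies `‖T x‖² ≤ (‖T‖ + 1) ⟪x, T x⟫`. -/
theorem norm_sq_apply_le_of_re_inner_nonneg (T : H →L[ℂ] H)
    (hs : ∀ x y : H, ⟪T x, y⟫_ℂ = ⟪x, T y⟫_ℂ) (hp : ∀ x : H, 0 ≤ (⟪x, T x⟫_ℂ).re) (x : H) :
    ‖T x‖ ^ 2 ≤ (‖T‖ + 1) * (⟪x, T x⟫_ℂ).re := by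
  have hm : 0 < ‖T‖ + 1 := by positivity
  have h := hp (((‖T‖ + 1 : ℝ) : ℂ) • x - T x)
  have hcs : (⟪T x, T (T x)⟫_ℂ).re ≤ ‖T‖ * ‖T x‖ ^ 2 := by
    calc (⟪T x, T (T x)⟫_ℂ).re ≤ ‖T x‖ * ‖T (T x)‖ := re_inner_le_norm (𝕜 := ℂ) _ _
      _ ≤ ‖T x‖ * (‖T‖ * ‖T x‖) := by gcongr; exact T.le_opNorm _
      _ = ‖T‖ * ‖T x‖ ^ 2 := by ring
  have hexp : (⟪((‖T‖ + 1 : ℝ) : ℂ) • x - T x, T (((‖T‖ + 1 : ℝ) : ℂ) • x - T x)⟫_ℂ).re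
      = (‖T‖ + 1) ^ 2 * (⟪x, T x⟫_ℂ).re - 2 * (‖T‖ + 1) * ‖T x‖ ^ 2
        + (⟪T x, T (T x)⟫_ℂ).re := by
    have h1 : ⟪x, T (T x)⟫_ℂ = ((‖T x‖ ^ 2 : ℝ) : ℂ) := by
      rw [← hs, inner_self_eq_norm_sq_to_K]; norm_cast
    have h2 : ⟪T x, T x⟫_ℂ = ((‖T x‖ ^ 2 : ℝ) : ℂ) := by
      rw [inner_self_eq_norm_sq_to_K]; norm_cast
    simp only [map_sub, map_smul, inner_sub_left, inner_sub_right, inner_smul_left,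
      inner_smul_right, h1, h2, Complex.conj_ofReal, Complex.sub_re, Complex.re_ofReal_mul,
      Complex.ofReal_re]
    ring
  rw [hexp] at h
  have hle : (‖T‖ + 1) * ‖T x‖ ^ 2 ≤ (‖T‖ + 1) * ((‖T‖ + 1) * (⟪x, T x⟫_ℂ).re) := by
    nlinarith [sq_nonneg ‖T x‖]
  exact le_of_mul_le_mul_left hle hm

/-- An invertible bounded positive operator is coercive. -/
theorem exists_pos_mul_norm_sq_le_re_inner (T : H →L[ℂ] H) (hT : IsUnit T)
    (hs : ∀ x y : H, ⟪T x, y⟫_ℂ = ⟪x, T y⟫_ℂ) (hp : ∀ x : H, 0 ≤ (⟪x, T x⟫_ℂ).re) :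
    ∃ c : ℝ, 0 < c ∧ ∀ x : H, c * ‖x‖ ^ 2 ≤ (⟪x, T x⟫_ℂ).re := by
  obtain ⟨u, rfl⟩ := hT
  set S : H →L[ℂ] H := ↑u⁻¹ with hS
  refine ⟨1 / ((‖S‖ ^ 2 + 1) * (‖(u : H →L[ℂ] H)‖ + 1)), by positivity, fun x => ?_⟩
  have h1 := norm_sq_apply_le_of_re_inner_nonneg (u : H →L[ℂ] H) hs hp x
  have h2 : S ((u : H →L[ℂ] H) x) = x := by
    rw [hS, ← mul_apply_eq_comp, u.inv_mul, one_apply_eq_self]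
  have h3 : ‖x‖ ^ 2 ≤ (‖S‖ ^ 2 + 1) * ‖(u : H →L[ℂ] H) x‖ ^ 2 := by
    have h4 : ‖x‖ ≤ ‖S‖ * ‖(u : H →L[ℂ] H) x‖ := by
      conv_lhs => rw [← h2]
      exact S.le_opNorm _
    have h5 : ‖x‖ ^ 2 ≤ (‖S‖ * ‖(u : H →L[ℂ] H) x‖) ^ 2 := by gcongr
    nlinarith [sq_nonneg ‖(u : H →L[ℂ] H) x‖]
  rw [one_div, inv_mul_le_iff₀ (by positivity)]
  calc ‖x‖ ^ 2 ≤ (‖S‖ ^ 2 + 1) * ‖(u : H →L[ℂ] H) x‖ ^ 2 := h3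
    _ ≤ (‖S‖ ^ 2 + 1) * ((‖(u : H →L[ℂ] H)‖ + 1) * (⟪x, (u : H →L[ℂ] H) x⟫_ℂ).re) := by gcongr
    _ = _ := by ring

theorem HasDerivAt.re_inner_self_apply [NormedSpace ℝ H] [IsScalarTower ℝ ℂ H] (T : H →L[ℂ] H)
    (hs : ∀ x y : H, ⟪T x, y⟫_ℂ = ⟪x, T y⟫_ℂ) {U : ℝ → H} {v : H} {t : ℝ}
    (hU : HasDerivAt U v t) :
    HasDerivAt (fun t => (⟪U t, T (U t)⟫_ℂ).re) (2 * (⟪U t, T v⟫_ℂ).re) t := by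
  have hT : HasDerivAt (fun t => T (U t)) (T v) t :=
    (T.restrictScalars ℝ).hasFDerivAt.comp_hasDerivAt t hU
  have h := Complex.reCLM.hasFDerivAt.comp_hasDerivAt t (hU.inner ℂ hT)
  refine h.congr_deriv ?_
  rw [Complex.reCLM_apply, Complex.add_re, ← hs v, ← inner_conj_symm (T v) (U t),
    Complex.conj_re]
  exact (two_mul _).symm

theorem le_add_of_sq_le_four_mul {p u v : ℝ} (hu : 0 ≤ u) (hv : 0 ≤ v)
    (h : p ^ 2 ≤ 4 * (u * v)) : p ≤ u + v :=
  le_of_sq_le_sq (by nlinarith [sq_nonneg (u - v)]) (by positivity)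

theorem dissipation_le {c M δ ξ N ℓ b q pL pB : ℝ} (hc : 0 < c) (hM : 0 ≤ M) (hδ : 0 < δ)
    (hδM : δ * (1 + M / c) ≤ 1) (hℓ : 0 ≤ ℓ) (hb : 0 ≤ b) (hq : c * N ^ 2 ≤ q + b + ℓ)
    (hpL : pL ^ 2 ≤ M * ℓ * N ^ 2) (hpB : pB ^ 2 ≤ M * b * N ^ 2) :
    -ℓ - ξ ^ 2 * b - δ * ξ / (1 + ξ ^ 2) * ξ * q + δ * ξ / (1 + ξ ^ 2) * (pL + ξ ^ 2 * pB)
      ≤ -(δ * c / 2 * (ξ ^ 2 / (1 + ξ ^ 2)) * N ^ 2) := by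
  have hy : 0 < 1 + ξ ^ 2 := by positivity
  set r := ξ ^ 2 / (1 + ξ ^ 2) with hr
  have hr0 : 0 ≤ r := by positivity
  have hr1 : r ≤ 1 := by rw [hr, div_le_one hy]; linarith
  have hrξ : r ≤ ξ ^ 2 := by
    rw [hr, div_le_iff₀ hy]; nlinarith [sq_nonneg (ξ ^ 2)]
  have hsr : (ξ / (1 + ξ ^ 2)) ^ 2 ≤ r := by
    rw [hr, div_pow, div_le_div_iff₀ (by positivity) hy]
    nlinarith [mul_nonneg (sq_nonneg ξ) hy.le,
      mul_nonneg (mul_nonneg (sq_nonneg ξ) hy.le) (sq_nonneg ξ)]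
  have hL : ξ / (1 + ξ ^ 2) * pL ≤ r * c / 4 * N ^ 2 + M / c * ℓ := by
    refine le_add_of_sq_le_four_mul (by positivity) (by positivity) ?_
    calc (ξ / (1 + ξ ^ 2) * pL) ^ 2 = (ξ / (1 + ξ ^ 2)) ^ 2 * pL ^ 2 := by ring
      _ ≤ r * (M * ℓ * N ^ 2) := by gcongr
      _ = 4 * (r * c / 4 * N ^ 2 * (M / c * ℓ)) := by field_simp
  have hB : r * ξ * pB ≤ r * c / 4 * N ^ 2 + M / c * (ξ ^ 2 * b) := by
    refine le_add_of_sq_le_four_mul (by positivity) (by positivity) ?_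
    calc (r * ξ * pB) ^ 2 = r * (r * (ξ ^ 2 * pB ^ 2)) := by ring
      _ ≤ r * (1 * (ξ ^ 2 * (M * b * N ^ 2))) := by gcongr
      _ = 4 * (r * c / 4 * N ^ 2 * (M / c * (ξ ^ 2 * b))) := by field_simp
  have hQ : r * (c * N ^ 2) ≤ r * q + ξ ^ 2 * b + ℓ := by
    nlinarith [mul_le_mul_of_nonneg_left hq hr0, mul_le_mul_of_nonneg_right hrξ hb,
      mul_le_mul_of_nonneg_right hr1 hℓ]
  have hsum : -(r * q) + ξ / (1 + ξ ^ 2) * pL + r * ξ * pB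
      ≤ -(c / 2 * r * N ^ 2) + (1 + M / c) * (ℓ + ξ ^ 2 * b) := by linarith
  have hfin := mul_le_mul_of_nonneg_right hδM (show 0 ≤ ℓ + ξ ^ 2 * b by positivity)
  have hδsum := mul_le_mul_of_nonneg_left hsum hδ.le
  have hrew : -ℓ - ξ ^ 2 * b - δ * ξ / (1 + ξ ^ 2) * ξ * q
      + δ * ξ / (1 + ξ ^ 2) * (pL + ξ ^ 2 * pB)
      = -ℓ - ξ ^ 2 * b + δ * (-(r * q) + ξ / (1 + ξ ^ 2) * pL + r * ξ * pB) := by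
    rw [hr]; ring
  rw [hrew]
  linarith

theorem le_mul_exp_of_hasDerivAt_le {E E' : ℝ → ℝ} {κ : ℝ}
    (hE : ∀ t, 0 ≤ t → HasDerivAt E (E' t) t) (hle : ∀ t, 0 ≤ t → E' t ≤ -(κ * E t))
    {t : ℝ} (ht : 0 ≤ t) : E t ≤ E 0 * Real.exp (-(κ * t)) := by
  have hd : ∀ s, 0 ≤ s → HasDerivAt (fun s => E s * Real.exp (κ * s))
      (E' s * Real.exp (κ * s) + E s * (Real.exp (κ * s) * κ)) s := fun s hs => by
    have h : HasDerivAt (fun s : ℝ => κ * s) κ s := by simpa using (hasDerivAt_id s).const_mul κ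
    exact (hE s hs).mul h.exp
  have hanti : AntitoneOn (fun s => E s * Real.exp (κ * s)) (Set.Ici 0) := by
    refine antitoneOn_of_hasDerivWithinAt_nonpos (convex_Ici 0)
      (fun s hs => (hd s hs).continuousAt.continuousWithinAt)
      (fun s hs => (hd s (interior_subset hs)).hasDerivWithinAt) fun s hs => ?_
    have := mul_le_mul_of_nonneg_right (hle s (interior_subset hs)) (Real.exp_pos (κ * s)).le
    linarith
  have h := hanti Set.self_mem_Ici (Set.mem_Ici.2 ht) ht
  simp only [mul_zero, Real.exp_zero, mul_one] at h
  rw [Real.exp_neg, ← div_eq_mul_inv, le_div_iff₀ (Real.exp_pos _)]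
  exact h

/-- Decay of solutions of `A₀ U' + iξ A₁ U + L U + ξ² B U = 0` on a Hilbert space in the presence
of a compensating operator `K`. -/
theorem exists_decay_of_compensating [NormedSpace ℝ H] [IsScalarTower ℝ ℂ H]
    (A₀ A₁ B L K : H →L[ℂ] H)
    (hA₀ : ∀ x y : H, ⟪A₀ x, y⟫_ℂ = ⟪x, A₀ y⟫_ℂ) (hA₁ : ∀ x y : H, ⟪A₁ x, y⟫_ℂ = ⟪x, A₁ y⟫_ℂ)
    (hB : ∀ x y : H, ⟪B x, y⟫_ℂ = ⟪x, B y⟫_ℂ) (hL : ∀ x y : H, ⟪L x, y⟫_ℂ = ⟪x, L y⟫_ℂ)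
    (hBp : ∀ x : H, 0 ≤ (⟪x, B x⟫_ℂ).re) (hLp : ∀ x : H, 0 ≤ (⟪x, L x⟫_ℂ).re)
    {a : ℝ} (ha : 0 < a) (hA₀p : ∀ x : H, a * ‖x‖ ^ 2 ≤ (⟪x, A₀ x⟫_ℂ).re)
    (hKA₀ : ∀ x y : H, ⟪K (A₀ x), y⟫_ℂ = -⟪x, K (A₀ y)⟫_ℂ)
    {c : ℝ} (hc : 0 < c)
    (hK : ∀ x : H, c * ‖x‖ ^ 2
      ≤ (⟪x, K (A₁ x)⟫_ℂ).re + (⟪x, B x⟫_ℂ).re + (⟪x, L x⟫_ℂ).re) :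
    ∃ C k : ℝ, 0 < C ∧ 0 < k ∧ ∀ ξ : ℝ, ∀ U U' : ℝ → H,
      (∀ t, 0 ≤ t → HasDerivAt U (U' t) t) →
      (∀ t, 0 ≤ t → A₀ (U' t) + (Complex.I * ξ) • A₁ (U t) + L (U t)
        + ((ξ : ℂ) ^ 2) • B (U t) = 0) →
      ∀ t, 0 ≤ t → ‖U t‖ ≤ C * ‖U 0‖ * Real.exp (-(k * ξ ^ 2 * t / (1 + ξ ^ 2))) := by
  set M : ℝ := ‖K‖ ^ 2 * (‖L‖ + ‖B‖ + 1) with hM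
  have hM0 : 0 ≤ M := by positivity
  set δ : ℝ := min (1 / (1 + M / c)) (a / (2 * (‖K ∘L A₀‖ + 1))) with hδdef
  have hδ : 0 < δ := by rw [hδdef]; positivity
  have hδM : δ * (1 + M / c) ≤ 1 := by
    rw [← le_div_iff₀ (by positivity)]; exact min_le_left _ _
  have hδa : δ * ‖K ∘L A₀‖ ≤ a / 2 := by
    have h : δ * (2 * (‖K ∘L A₀‖ + 1)) ≤ a := by
      rw [← le_div_iff₀ (by positivity)]; exact min_le_right _ _
    linarith
  set β : ℝ := ‖A₀‖ + a / 2 with hβdef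
  have hβ : 0 < β := by positivity
  refine ⟨Real.sqrt (2 * β / a), δ * c / (2 * β), by positivity, by positivity, ?_⟩
  intro ξ U U' hU hode t ht
  set s : ℝ := δ * ξ / (1 + ξ ^ 2) with hs
  have hsδ : |s| ≤ δ := by
    rw [hs, abs_div, abs_mul, abs_of_pos hδ, abs_of_pos (by positivity : 0 < 1 + ξ ^ 2),
      div_le_iff₀ (by positivity)]
    have : |ξ| ≤ 1 + ξ ^ 2 := by nlinarith [sq_nonneg (|ξ| - 1), sq_abs ξ, abs_nonneg ξ]
    gcongr
  set T : H →L[ℂ] H := A₀ - ((s : ℂ) * Complex.I) • (K ∘L A₀) with hT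
  have hTapp : ∀ x y : H,
      ⟪x, T y⟫_ℂ = ⟪x, A₀ y⟫_ℂ - (s : ℂ) * Complex.I * ⟪x, K (A₀ y)⟫_ℂ := fun x y => by
    simp [hT, mul_comm]
  have hTs : ∀ x y : H, ⟪T x, y⟫_ℂ = ⟪x, T y⟫_ℂ := fun x y => by
    rw [hTapp]
    simp [hT, hA₀, hKA₀, mul_comm]
  have hpert : ∀ x : H, |((s : ℂ) * Complex.I * ⟪x, K (A₀ x)⟫_ℂ).re| ≤ a / 2 * ‖x‖ ^ 2 :=
    fun x => by
      calc |((s : ℂ) * Complex.I * ⟪x, K (A₀ x)⟫_ℂ).re|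
          ≤ ‖(s : ℂ) * Complex.I * ⟪x, K (A₀ x)⟫_ℂ‖ := Complex.abs_re_le_norm _
        _ = |s| * ‖⟪x, (K ∘L A₀) x⟫_ℂ‖ := by simp
        _ ≤ δ * (‖x‖ * (‖K ∘L A₀‖ * ‖x‖)) := by
          gcongr
          exact (norm_inner_le_norm _ _).trans (by gcongr; exact (K ∘L A₀).le_opNorm _)
        _ = δ * ‖K ∘L A₀‖ * ‖x‖ ^ 2 := by ring
        _ ≤ a / 2 * ‖x‖ ^ 2 := by gcongr
  have hlow : ∀ x : H, a / 2 * ‖x‖ ^ 2 ≤ (⟪x, T x⟫_ℂ).re := fun x => by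
    rw [hTapp, Complex.sub_re]
    linarith [hA₀p x, (abs_le.1 (hpert x)).2]
  have hup : ∀ x : H, (⟪x, T x⟫_ℂ).re ≤ β * ‖x‖ ^ 2 := fun x => by
    rw [hTapp, Complex.sub_re]
    have h : (⟪x, A₀ x⟫_ℂ).re ≤ ‖A₀‖ * ‖x‖ ^ 2 := by
      calc (⟪x, A₀ x⟫_ℂ).re ≤ ‖x‖ * ‖A₀ x‖ := re_inner_le_norm (𝕜 := ℂ) _ _
        _ ≤ ‖x‖ * (‖A₀‖ * ‖x‖) := by gcongr; exact A₀.le_opNorm _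
        _ = ‖A₀‖ * ‖x‖ ^ 2 := by ring
    rw [hβdef]
    linarith [(abs_le.1 (hpert x)).1]
  have hcross : ∀ (S : H →L[ℂ] H), (∀ x y : H, ⟪S x, y⟫_ℂ = ⟪x, S y⟫_ℂ) →
      (∀ x : H, 0 ≤ (⟪x, S x⟫_ℂ).re) → ‖S‖ ≤ ‖L‖ + ‖B‖ → ∀ x : H,
      (-(⟪x, K (S x)⟫_ℂ).im) ^ 2 ≤ M * (⟪x, S x⟫_ℂ).re * ‖x‖ ^ 2 := by
    intro S hSs hSp hSn x
    have h1 : |(⟪x, K (S x)⟫_ℂ).im| ≤ ‖x‖ * (‖K‖ * ‖S x‖) :=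
      (Complex.abs_im_le_norm _).trans
        ((norm_inner_le_norm _ _).trans (by gcongr; exact K.le_opNorm _))
    have h0 := hSp x
    calc (-(⟪x, K (S x)⟫_ℂ).im) ^ 2 = |(⟪x, K (S x)⟫_ℂ).im| ^ 2 := by rw [neg_sq, sq_abs]
      _ ≤ (‖x‖ * (‖K‖ * ‖S x‖)) ^ 2 := by gcongr
      _ = ‖x‖ ^ 2 * ‖K‖ ^ 2 * ‖S x‖ ^ 2 := by ring
      _ ≤ ‖x‖ ^ 2 * ‖K‖ ^ 2 * ((‖S‖ + 1) * (⟪x, S x⟫_ℂ).re) := by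
        gcongr
        exact norm_sq_apply_le_of_re_inner_nonneg S hSs hSp x
      _ ≤ ‖x‖ ^ 2 * ‖K‖ ^ 2 * ((‖L‖ + ‖B‖ + 1) * (⟪x, S x⟫_ℂ).re) := by gcongr
      _ = M * (⟪x, S x⟫_ℂ).re * ‖x‖ ^ 2 := by rw [hM]; ring
  set r : ℝ := ξ ^ 2 / (1 + ξ ^ 2) with hr
  have hr0 : 0 ≤ r := by positivity
  have hdiss : ∀ t, 0 ≤ t →
      2 * (⟪U t, T (U' t)⟫_ℂ).re ≤ -(δ * c / β * r * (⟪U t, T (U t)⟫_ℂ).re) := by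
    intro t ht
    set x := U t
    have hA : A₀ (U' t) = -((Complex.I * ξ) • A₁ x + L x + ((ξ : ℂ) ^ 2) • B x) := by
      rw [eq_neg_iff_add_eq_zero, ← hode t ht]; abel
    have him : (⟪x, A₁ x⟫_ℂ).im = 0 := by
      rw [← Complex.conj_eq_iff_im, inner_conj_symm, hA₁]
    have hre : (⟪x, T (U' t)⟫_ℂ).re = -(⟪x, L x⟫_ℂ).re - ξ ^ 2 * (⟪x, B x⟫_ℂ).re
        - s * ξ * (⟪x, K (A₁ x)⟫_ℂ).re
        + s * (-(⟪x, K (L x)⟫_ℂ).im + ξ ^ 2 * -(⟪x, K (B x)⟫_ℂ).im) := by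
      rw [hTapp, hA]
      simp only [map_neg, map_add, map_smul, inner_neg_right, inner_add_right, inner_smul_right]
      simp [him, ← Complex.ofReal_pow]
      ring
    have hmain := dissipation_le (ξ := ξ) hc hM0 hδ hδM (hLp x) (hBp x) (hK x)
      (hcross L hL hLp (by linarith [norm_nonneg B]) x)
      (hcross B hB hBp (by linarith [norm_nonneg L]) x)
    rw [← hs, ← hre] at hmain
    have h := mul_le_mul_of_nonneg_left (hup x) (show 0 ≤ δ * c / β * r by positivity)
    have h2 : δ * c / β * r * (β * ‖x‖ ^ 2) = δ * c * r * ‖x‖ ^ 2 := by field_simp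
    linarith
  have hdecay := le_mul_exp_of_hasDerivAt_le
    (fun t ht => (hU t ht).re_inner_self_apply T hTs) hdiss ht
  have hsq : ‖U t‖ ^ 2 ≤ (Real.sqrt (2 * β / a) * ‖U 0‖
      * Real.exp (-(δ * c / (2 * β) * ξ ^ 2 * t / (1 + ξ ^ 2)))) ^ 2 := by
    rw [mul_pow, mul_pow, Real.sq_sqrt (by positivity), ← Real.exp_nat_mul]
    have hexp : ((2 : ℕ) : ℝ) * -(δ * c / (2 * β) * ξ ^ 2 * t / (1 + ξ ^ 2))
        = -(δ * c / β * r * t) := by rw [hr]; push_cast; field_simp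
    rw [hexp]
    have h := (hlow (U t)).trans (hdecay.trans
      (mul_le_mul_of_nonneg_right (hup (U 0)) (Real.exp_pos _).le))
    have h2 : 2 * β / a * ‖U 0‖ ^ 2 * Real.exp (-(δ * c / β * r * t))
        = 2 / a * (β * ‖U 0‖ ^ 2 * Real.exp (-(δ * c / β * r * t))) := by ring
    calc ‖U t‖ ^ 2 = 2 / a * (a / 2 * ‖U t‖ ^ 2) := by field_simp
      _ ≤ _ := by rw [h2]; gcongr
  exact le_of_sq_le_sq hsq (by positivity)

end HilbertSpace

section Complexification

open scoped InnerProductSpace ComplexOrder MatrixOrder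

variable {ι : Type*} [Fintype ι] [DecidableEq ι]

theorem Matrix.PosSemidef.map_ofReal {A : Matrix ι ι ℝ} (hA : A.PosSemidef) :
    (A.map Complex.ofReal).PosSemidef := by
  obtain ⟨R, rfl⟩ := CStarAlgebra.nonneg_iff_eq_star_mul_self.mp hA.nonneg
  have h : (star R * R).map Complex.ofReal
      = (R.map Complex.ofReal)ᴴ * R.map Complex.ofReal := by
    have hR : (R.map Complex.ofReal)ᴴ = Rᴴ.map Complex.ofReal := by
      ext i j
      simp
    rw [hR]
    exact Matrix.map_mul (f := Complex.ofRealHom)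
  rw [h]
  exact posSemidef_conjTranspose_mul_self _

/-- The operator on complex Euclidean space given by a real matrix. -/
noncomputable def Matrix.complexCLM (A : Matrix ι ι ℝ) :
    EuclideanSpace ℂ ι →L[ℂ] EuclideanSpace ℂ ι :=
  toEuclideanCLM (n := ι) (𝕜 := ℂ) (A.map Complex.ofReal)

theorem Matrix.complexCLM_mul_apply (A B : Matrix ι ι ℝ) (x : EuclideanSpace ℂ ι) :
    (A * B).complexCLM x = A.complexCLM (B.complexCLM x) := by
  have h : (A * B).map Complex.ofReal = A.map Complex.ofReal * B.map Complex.ofReal :=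
    Matrix.map_mul (f := Complex.ofRealHom)
  rw [complexCLM, h, map_mul]
  rfl

theorem Matrix.inner_complexCLM_left (A : Matrix ι ι ℝ) (x y : EuclideanSpace ℂ ι) :
    ⟪A.complexCLM x, y⟫_ℂ = ⟪x, Aᵀ.complexCLM y⟫_ℂ := by
  have h : Aᵀ.map Complex.ofReal = star (A.map Complex.ofReal) := by
    ext i j
    simp
  rw [complexCLM, complexCLM, h, map_star, ContinuousLinearMap.star_eq_adjoint,
    ContinuousLinearMap.adjoint_inner_right]

theorem Matrix.PosSemidef.re_inner_complexCLM_nonneg {A : Matrix ι ι ℝ} (hA : A.PosSemidef)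
    (x : EuclideanSpace ℂ ι) : 0 ≤ (⟪x, A.complexCLM x⟫_ℂ).re := by
  rw [EuclideanSpace.inner_eq_star_dotProduct, dotProduct_comm]
  exact hA.map_ofReal.re_dotProduct_nonneg x.ofLp

theorem Matrix.PosDef.exists_pos_mul_norm_sq_le_re_inner_complexCLM {A : Matrix ι ι ℝ}
    (hA : A.PosDef) :
    ∃ c : ℝ, 0 < c ∧ ∀ x : EuclideanSpace ℂ ι, c * ‖x‖ ^ 2 ≤ (⟪x, A.complexCLM x⟫_ℂ).re := by
  have hT : Aᵀ = A := by simpa using hA.isHermitian.eq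
  refine exists_pos_mul_norm_sq_le_re_inner A.complexCLM ?_ (fun x y => ?_)
    hA.posSemidef.re_inner_complexCLM_nonneg
  · exact (hA.isUnit.map (Complex.ofRealHom.mapMatrix (m := ι))).map
      (toEuclideanCLM (n := ι) (𝕜 := ℂ))
  · rw [inner_complexCLM_left, hT]

end Complexification

/-- Existence of a compensating function implies the pointwise-in-frequency decay
estimate `|Û(ξ,t)| ≤ C|Û(ξ,0)| exp(−kξ²t/(1+ξ²))` for solutions of the
Fourier-transformed linear system `A⁰Û_t + iξA¹Û + LÛ + ξ²BÛ = 0`. -/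
theorem compensating_implies_fourier_decay (n : ℕ) (hn : 1 ≤ n)
    (A0 A1 B L : Matrix (Fin n) (Fin n) ℝ)
    (hA0s : A0.IsSymm) (hA1s : A1.IsSymm) (hBs : B.IsSymm) (hLs : L.IsSymm)
    (hA0 : A0.PosDef) (hB : B.PosSemidef) (hL : L.PosSemidef)
    (K : Matrix (Fin n) (Fin n) ℝ)
    (hK1 : (K * A0)ᵀ = -(K * A0))
    (hK2 : ((1 / 2 : ℝ) • (K * A1 + (K * A1)ᵀ) + B + L).PosDef) :
    ∃ C k : ℝ, 0 < C ∧ 0 < k ∧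
      ∀ ξ : ℝ, ∀ U U' : ℝ → EuclideanSpace ℂ (Fin n),
        (∀ t : ℝ, 0 ≤ t → HasDerivAt U (U' t) t) →
        (∀ t : ℝ, 0 ≤ t →
          (A0.map (Complex.ofReal)).mulVec (U' t)
            + (Complex.I * ξ) • (A1.map (Complex.ofReal)).mulVec (U t)
            + (L.map (Complex.ofReal)).mulVec (U t)
            + ((ξ : ℂ) ^ 2) • (B.map (Complex.ofReal)).mulVec (U t) = 0) →
        ∀ t : ℝ, 0 ≤ t →
          ‖U t‖ ≤ C * ‖U 0‖ * Real.exp (-(k * ξ ^ 2 * t / (1 + ξ ^ 2))) := by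
  have hsymm : ∀ {A : Matrix (Fin n) (Fin n) ℝ}, A.IsSymm → ∀ x y : EuclideanSpace ℂ (Fin n),
      inner ℂ (A.complexCLM x) y = inner ℂ x (A.complexCLM y) := fun hA x y => by
    rw [inner_complexCLM_left, hA.eq]
  obtain ⟨a, ha, hA0p⟩ := hA0.exists_pos_mul_norm_sq_le_re_inner_complexCLM
  obtain ⟨c, hc, hKp⟩ := hK2.exists_pos_mul_norm_sq_le_re_inner_complexCLM
  have hKA0 : ∀ x y : EuclideanSpace ℂ (Fin n),
      inner ℂ (K.complexCLM (A0.complexCLM x)) y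
        = -inner ℂ x (K.complexCLM (A0.complexCLM y)) := fun x y => by
    rw [← complexCLM_mul_apply, ← complexCLM_mul_apply, inner_complexCLM_left, hK1,
      ← inner_neg_right]
    congr 1
    have h : (-(K * A0)).map Complex.ofReal = -(K * A0).map Complex.ofReal := by ext; simp
    rw [complexCLM, h, map_neg]
    rfl
  have hK : ∀ x : EuclideanSpace ℂ (Fin n), c * ‖x‖ ^ 2
      ≤ (inner ℂ x (K.complexCLM (A1.complexCLM x))).re + (inner ℂ x (B.complexCLM x)).re
        + (inner ℂ x (L.complexCLM x)).re := fun x => by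
    refine (hKp x).trans_eq ?_
    have h : ((1 / 2 : ℝ) • (K * A1 + (K * A1)ᵀ) + B + L).map Complex.ofReal
        = (1 / 2 : ℂ) • ((K * A1).map Complex.ofReal + (K * A1)ᵀ.map Complex.ofReal)
          + B.map Complex.ofReal + L.map Complex.ofReal := by
      ext; simp
    have hsplit : ((1 / 2 : ℝ) • (K * A1 + (K * A1)ᵀ) + B + L).complexCLM x
        = (1 / 2 : ℂ) • ((K * A1).complexCLM x + (K * A1)ᵀ.complexCLM x)
          + B.complexCLM x + L.complexCLM x := by
      rw [complexCLM, h, map_add, map_add, map_smul, map_add]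
      rfl
    have hre : (inner ℂ x ((K * A1)ᵀ.complexCLM x)).re
        = (inner ℂ x ((K * A1).complexCLM x)).re := by
      rw [← inner_complexCLM_left, ← inner_conj_symm, Complex.conj_re]
    have hhalf : (1 / 2 : ℂ) = ((1 / 2 : ℝ) : ℂ) := by norm_num
    rw [hsplit, ← complexCLM_mul_apply, inner_add_right, inner_add_right, inner_smul_right,
      inner_add_right, hhalf, Complex.add_re, Complex.add_re, Complex.re_ofReal_mul,
      Complex.add_re, hre]
    ring
  obtain ⟨C, k, hC, hk, h⟩ := exists_decay_of_compensating A0.complexCLM A1.complexCLM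
    B.complexCLM L.complexCLM K.complexCLM (hsymm hA0s) (hsymm hA1s) (hsymm hBs) (hsymm hLs)
    hB.re_inner_complexCLM_nonneg hL.re_inner_complexCLM_nonneg ha hA0p hKA0 hc hK
  refine ⟨C, k, hC, hk, fun ξ U U' hU hode => h ξ U U' hU fun t ht => ?_⟩
  exact WithLp.ofLp_injective 2 (hode t ht)
end

section
/- For every real k > 0 and every integer l ≥ 0, the function A(t) := (1 + t)^{l + 1/2} ∫_{−1}^{1} ξ^{2l} e^{−k ξ² t} dξ is bounded on [0, ∞); that is, sup_{t ≥ 0} A(t) < ∞. -/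
theorem integrable_pow_mul_exp_neg_mul_sq {b : ℝ} (hb : 0 < b) (n : ℕ) :
    MeasureTheory.Integrable fun x : ℝ => x ^ n * Real.exp (-b * x ^ 2) := by
  have hn : (-1 : ℝ) < n := by linarith [n.cast_nonneg (α := ℝ)]
  simpa only [Real.rpow_natCast] using integrable_rpow_mul_exp_neg_mul_sq hb hn

theorem Real.rpow_natCast_add_half {x : ℝ} (hx : 0 < x) (l : ℕ) :
    x ^ ((l : ℝ) + 1 / 2) = √x ^ (2 * l) * √x := by
  rw [Real.rpow_add hx, Real.rpow_natCast, pow_mul, Real.sq_sqrt hx.le, Real.sqrt_eq_rpow]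

/-- The function `A(t) = (1+t)^{l+1/2} ∫_{−1}^{1} ξ^{2l} e^{−kξ²t} dξ` is bounded
on `[0, ∞)`. -/
theorem weighted_gaussian_integral_bounded (k : ℝ) (hk : 0 < k) (l : ℕ) :
    ∃ C : ℝ, ∀ t : ℝ, 0 ≤ t →
      (1 + t) ^ ((l : ℝ) + 1 / 2) *
          ∫ ξ in (-1 : ℝ)..1, ξ ^ (2 * l) * Real.exp (-(k * ξ ^ 2 * t)) ≤ C := by
  set f : ℝ → ℝ := fun u => u ^ (2 * l) * Real.exp (-k * u ^ 2) with hf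
  refine ⟨Real.exp k * ∫ u, f u, fun t ht => ?_⟩
  have hs : 0 ≤ √(1 + t) := Real.sqrt_nonneg _
  have hsq : √(1 + t) ^ 2 = 1 + t := Real.sq_sqrt (by linarith)
  rw [Real.rpow_natCast_add_half (by linarith)]
  set s := √(1 + t)
  have hpos : ∀ u, 0 ≤ f u := fun u =>
    mul_nonneg ((even_two_mul l).pow_nonneg u) (Real.exp_pos _).le
  have hbound : ∀ ξ ∈ Set.Icc (-1 : ℝ) 1,
      s ^ (2 * l) * (ξ ^ (2 * l) * Real.exp (-(k * ξ ^ 2 * t))) ≤ Real.exp k * f (s * ξ) := by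
    intro ξ hξ
    have hξ2 : ξ ^ 2 ≤ 1 := by nlinarith [hξ.1, hξ.2]
    have hexp : Real.exp (-(k * ξ ^ 2 * t)) ≤ Real.exp k * Real.exp (-k * (s * ξ) ^ 2) := by
      rw [← Real.exp_add, Real.exp_le_exp, mul_pow, hsq]
      nlinarith
    have hp : 0 ≤ (s * ξ) ^ (2 * l) := (even_two_mul l).pow_nonneg _
    calc s ^ (2 * l) * (ξ ^ (2 * l) * Real.exp (-(k * ξ ^ 2 * t)))
        = (s * ξ) ^ (2 * l) * Real.exp (-(k * ξ ^ 2 * t)) := by rw [mul_pow]; ring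
      _ ≤ (s * ξ) ^ (2 * l) * (Real.exp k * Real.exp (-k * (s * ξ) ^ 2)) := by gcongr
      _ = Real.exp k * f (s * ξ) := by simp only [hf]; ring
  calc s ^ (2 * l) * s * ∫ ξ in (-1 : ℝ)..1, ξ ^ (2 * l) * Real.exp (-(k * ξ ^ 2 * t))
      = s * ∫ ξ in (-1 : ℝ)..1,
          s ^ (2 * l) * (ξ ^ (2 * l) * Real.exp (-(k * ξ ^ 2 * t))) := by
        rw [intervalIntegral.integral_const_mul]; ring
    _ ≤ s * ∫ ξ in (-1 : ℝ)..1, Real.exp k * f (s * ξ) := by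
        refine mul_le_mul_of_nonneg_left (intervalIntegral.integral_mono_on (by norm_num)
          (Continuous.intervalIntegrable (by fun_prop) _ _)
          (Continuous.intervalIntegrable (by fun_prop) _ _) hbound) hs
    _ = Real.exp k * ∫ u in (-s)..s, f u := by
        rw [intervalIntegral.integral_const_mul, mul_left_comm,
          intervalIntegral.mul_integral_comp_mul_left, mul_neg_one, mul_one]
    _ ≤ Real.exp k * ∫ u, f u := by
        rw [intervalIntegral.integral_of_le (by linarith)]
        exact mul_le_mul_of_nonneg_left (MeasureTheory.setIntegral_le_integral
          (integrable_pow_mul_exp_neg_mul_sq hk _) (.of_forall hpos)) (Real.exp_pos k).le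
end

section
/- Fix real parameters ρ > 0, θ > 0, τ > 0, κ > 0, e_θ > 0, p_ρ > 0, p_θ > 0, u ∈ ℝ and ν ≥ 0. Then the linearized Cattaneo–Christov system is strictly dissipative with the Kawashima decay structure: there exists a constant k > 0 such that for every ξ ∈ ℝ with ξ ≠ 0 and every λ ∈ ℂ satisfying det(λ Â⁰ + iξ Â¹ + L̂ + ξ² B̂) = 0, one has Re λ ≤ −k ξ²/(1 + ξ²); in particular Re λ < 0 for all ξ ≠ 0. This holds both in the viscous case ν > 0 and in the pure thermal relaxation case ν = 0. -/
open Matrix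

open ComplexConjugate in
/-- The cross-term identity for two components `y`, `z` of an eigenmode. -/
theorem cross_term_identity {m n : ℝ} {lam y z Y Z : ℂ}
    (hy : lam * m * y = Y) (hz : lam * n * z = Z) :
    n * Y * conj z + m * y * conj Z = 2 * lam.re * n * m * y * conj z := by
  subst hy hz
  have h : lam + conj lam = 2 * lam.re := by
    rw [Complex.add_conj]; push_cast; ring
  simp only [map_mul, Complex.conj_ofReal]
  linear_combination (n * m * y * conj z : ℂ) * h

open ComplexConjugate in
/-- The energy identity for one component of an eigenmode. -/
theorem re_mul_normSq {m : ℝ} {lam y Y : ℂ} (hy : lam * m * y = Y) :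
    lam.re * (m * ‖y‖ ^ 2) = (Y * conj y).re := by
  subst hy
  have h : lam * m * y * conj y = lam * ((m * ‖y‖ ^ 2 : ℝ) : ℂ) := by
    rw [mul_assoc, Complex.mul_conj']; push_cast; ring
  rw [h, Complex.re_mul_ofReal]

set_option maxHeartbeats 400000 in
/-- For small dissipation, the Kawashima cross-term estimates are incompatible with unit energy. -/
theorem exists_rate_of_cross_estimates {α ρ β σ p g r l ν : ℝ}
    (hα : 0 < α) (hρ : 0 < ρ) (hβ : 0 < β) (hσ : 0 < σ) (hp : 0 < p) (hg : 0 < g)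
    (hr : 0 < r) (hl : 0 < l) (hν : 0 ≤ ν) :
    ∃ k : ℝ, 0 < k ∧ ∀ A V B Q z : ℝ, 0 ≤ A → 0 ≤ V → 0 ≤ B → 0 ≤ Q → 0 < z →
      α * A ^ 2 + ρ * V ^ 2 + β * B ^ 2 + σ * Q ^ 2 = 1 →
      l * Q ^ 2 + ν * z ^ 2 * V ^ 2 ≤ k →
      l * Q ^ 2 + ν * z ^ 2 * V ^ 2 ≤ k * z ^ 2 →
      z * (β * r * B ^ 2) ≤ β * l * Q * B + σ * z * (g * Q * V + r * Q ^ 2)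
        + z * k * β * σ * Q * B →
      z * (ρ * g * V ^ 2) ≤ z * ρ * r * Q * V + β * z * B * (p * A + g * B)
        + β * ν * z ^ 2 * B * V + z * k * ρ * β * B * V →
      z * (α * p * A ^ 2) ≤ z * α * g * B * A + α * ν * z ^ 2 * V * A + ρ * z * p * V ^ 2
        + z * k * α * ρ * V * A → False := by
  obtain ⟨M, hM⟩ : ∃ x, x = 1 + 1 / α + 1 / ρ + 1 / β + 1 / σ := ⟨_, rfl⟩
  have hα' : 0 < 1 / α := by positivity
  have hρ' : 0 < 1 / ρ := by positivity
  have hβ' : 0 < 1 / β := by positivity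
  have hσ' : 0 < 1 / σ := by positivity
  have hM1 : 1 ≤ M := by linarith
  have hM0 : 0 < M := by linarith
  have bound : ∀ {c x : ℝ}, 0 < c → 1 / c ≤ M → 0 ≤ x → c * x ^ 2 ≤ 1 → x ≤ M := by
    intro c x hc hcM hx h
    have h1 : x ^ 2 ≤ 1 / c := by rw [le_div_iff₀ hc]; linarith
    nlinarith
  obtain ⟨c₁, hc₁⟩ : ∃ x, x =
      (β * l * M + σ * (g * M + r * M) + β * σ * M * M) / (β * r) :=
    ⟨_, rfl⟩
  have hc₁0 : 0 < c₁ := by rw [hc₁]; positivity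
  obtain ⟨b, hb⟩ : ∃ x, x = c₁ + 1 := ⟨_, rfl⟩
  have hb0 : 0 < b := by linarith
  have hcb : c₁ ≤ b ^ 2 := by rw [hb]; nlinarith
  obtain ⟨c₂, hc₂⟩ : ∃ x, x =
      (ρ * r * M + β * b * (p * M + g * M) + β * M + ρ * β * M * M) / (ρ * g) :=
    ⟨_, rfl⟩
  have hc₂0 : 0 < c₂ := by rw [hc₂]; positivity
  obtain ⟨c₃, hc₃⟩ : ∃ x, x =
      (α * g * b * M + α * M + ρ * p * c₂ + α * ρ * M * M) / (α * p) :=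
    ⟨_, rfl⟩
  have hc₃0 : 0 < c₃ := by rw [hc₃]; positivity
  obtain ⟨C, hC⟩ : ∃ x, x = α * c₃ + ρ * c₂ + β * c₁ + σ * M := ⟨_, rfl⟩
  have hC0 : 0 < C := by rw [hC]; positivity
  obtain ⟨t, ht⟩ : ∃ x, x = 1 / (1 + C) := ⟨_, rfl⟩
  have ht0 : 0 < t := by rw [ht]; positivity
  have ht1 : t ≤ 1 := by rw [ht, div_le_one (by positivity)]; linarith
  have hCt : C * t < 1 := by rw [ht, mul_one_div, div_lt_one (by positivity)]; linarith
  have htt : t ^ 2 ≤ t := by nlinarith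
  obtain ⟨m, hm⟩ : ∃ x, x = min 1 (min l (1 / (1 + ν))) := ⟨_, rfl⟩
  have hm0 : 0 < m := by rw [hm]; positivity
  have hm1 : m ≤ 1 := hm ▸ min_le_left _ _
  have hml : m ≤ l := hm ▸ (min_le_right _ _).trans (min_le_left _ _)
  have hmν : ν * m ≤ 1 := by
    have h : m ≤ 1 / (1 + ν) := hm ▸ (min_le_right _ _).trans (min_le_right _ _)
    rw [le_div_iff₀ (by positivity)] at h
    linarith
  obtain ⟨k, hk⟩ : ∃ x, x = m * (t ^ 2) ^ 2 := ⟨_, rfl⟩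
  have hk0 : 0 < k := by rw [hk]; positivity
  refine ⟨k, hk0, ?_⟩
  intro A V B Q z hA hV hB hQ hz hE hD hDz h₁ h₂ h₃
  have hkt : k ≤ t ^ 2 := by
    calc k ≤ 1 * (t ^ 2) ^ 2 := by rw [hk]; gcongr
      _ ≤ t ^ 2 := by
        rw [one_mul]
        exact pow_le_of_le_one (by positivity) (htt.trans ht1) two_ne_zero
  have hA2' : 0 ≤ α * A ^ 2 := by positivity
  have hV2' : 0 ≤ ρ * V ^ 2 := by positivity
  have hB2' : 0 ≤ β * B ^ 2 := by positivity
  have hQ2' : 0 ≤ σ * Q ^ 2 := by positivity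
  have hlQ : 0 ≤ l * Q ^ 2 := by positivity
  have hAM : A ≤ M := bound hα (by linarith) hA (by linarith)
  have hVM : V ≤ M := bound hρ (by linarith) hV (by linarith)
  have hBM : B ≤ M := bound hβ (by linarith) hB (by linarith)
  have hQM : Q ≤ M := bound hσ (by linarith) hQ (by linarith)
  have hνV : 0 ≤ ν * z ^ 2 * V ^ 2 := by positivity
  have hkl : k ≤ l * (t ^ 2) ^ 2 := by rw [hk]; gcongr
  have hQt : Q ≤ t ^ 2 := by
    refine (sq_le_sq₀ (by positivity) (by positivity)).mp ?_
    refine le_of_mul_le_mul_left ?_ hl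
    linarith
  have hQz : Q ≤ t ^ 2 * z := by
    refine (sq_le_sq₀ (by positivity) (by positivity)).mp ?_
    refine le_of_mul_le_mul_left ?_ hl
    have := mul_le_mul_of_nonneg_right hkl (sq_nonneg z)
    linarith
  have hVt : ν * z * V ≤ t ^ 2 := by
    refine (sq_le_sq₀ (by positivity) (by positivity)).mp ?_
    have h : ν * (ν * z ^ 2 * V ^ 2) ≤ ν * k :=
      mul_le_mul_of_nonneg_left (by linarith) hν
    have h' : ν * k ≤ 1 * (t ^ 2) ^ 2 := by
      rw [hk, ← mul_assoc]; gcongr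
    linarith
  have hB2 : B ^ 2 ≤ c₁ * t ^ 2 := by
    rw [hc₁, div_mul_eq_mul_div, le_div_iff₀ (by positivity)]
    refine le_of_mul_le_mul_left ?_ hz
    calc z * (B ^ 2 * (β * r)) = z * (β * r * B ^ 2) := by ring
      _ ≤ β * l * Q * B + σ * z * (g * Q * V + r * (Q * Q)) + z * k * β * σ * Q * B := by
        linarith
      _ ≤ β * l * (t ^ 2 * z) * M + σ * z * (g * t ^ 2 * M + r * (t ^ 2 * M))
          + z * t ^ 2 * β * σ * M * M := by gcongr
      _ = _ := by ring
  have hBt : B ≤ b * t := by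
    refine (sq_le_sq₀ (by positivity) (by positivity)).mp ?_
    calc B ^ 2 ≤ c₁ * t ^ 2 := hB2
      _ ≤ b ^ 2 * t ^ 2 := by gcongr
      _ = _ := by ring
  have hV2 : V ^ 2 ≤ c₂ * t := by
    rw [hc₂, div_mul_eq_mul_div, le_div_iff₀ (by positivity)]
    refine le_of_mul_le_mul_left ?_ hz
    calc z * (V ^ 2 * (ρ * g)) = z * (ρ * g * V ^ 2) := by ring
      _ ≤ z * ρ * r * Q * V + β * z * B * (p * A + g * B)
          + β * z * B * (ν * z * V) + z * k * ρ * β * B * V := by linarith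
      _ ≤ z * ρ * r * t * M + β * z * (b * t) * (p * M + g * M)
          + β * z * M * t + z * t * ρ * β * M * M := by
        gcongr
        · exact hQt.trans htt
        · exact hVt.trans htt
        · exact hkt.trans htt
      _ = _ := by ring
  have hA2 : A ^ 2 ≤ c₃ * t := by
    rw [hc₃, div_mul_eq_mul_div, le_div_iff₀ (by positivity)]
    refine le_of_mul_le_mul_left ?_ hz
    calc z * (A ^ 2 * (α * p)) = z * (α * p * A ^ 2) := by ring
      _ ≤ z * α * g * B * A + α * z * (ν * z * V) * A + ρ * z * p * V ^ 2
        + z * k * α * ρ * V * A := by linarith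
      _ ≤ z * α * g * (b * t) * M + α * z * t * M + ρ * z * p * (c₂ * t)
          + z * t * α * ρ * M * M := by
        gcongr
        · exact hVt.trans htt
        · exact hkt.trans htt
      _ = _ := by ring
  have hlt : α * A ^ 2 + ρ * V ^ 2 + β * B ^ 2 + σ * (Q * Q) < 1 := by
    calc α * A ^ 2 + ρ * V ^ 2 + β * B ^ 2 + σ * (Q * Q)
        ≤ α * (c₃ * t) + ρ * (c₂ * t) + β * (c₁ * t) + σ * (t * M) := by
          gcongr
          · exact hB2.trans (by gcongr)
          · exact hQt.trans htt
      _ = C * t := by rw [hC]; ring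
      _ < 1 := hCt
  linarith

open ComplexConjugate in
/-- The decay rate of eigenmodes of unit energy, for the acoustic–thermal chain coupling
`a`, `v`, `b`, `q`. -/
theorem exists_rate_of_unit_energy {α ρ β σ p g r l ν : ℝ}
    (hα : 0 < α) (hρ : 0 < ρ) (hβ : 0 < β) (hσ : 0 < σ) (hp : 0 < p) (hg : 0 < g)
    (hr : 0 < r) (hl : 0 < l) (hν : 0 ≤ ν) :
    ∃ k : ℝ, 0 < k ∧ ∀ ξ : ℝ, ξ ≠ 0 → ∀ lam a v b q : ℂ,
      lam * α * a = -(Complex.I * ξ * p * v) →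
      lam * ρ * v = -(Complex.I * ξ * (p * a + g * b)) - ν * ξ ^ 2 * v →
      lam * β * b = -(Complex.I * ξ * (g * v + r * q)) →
      lam * σ * q = -(Complex.I * ξ * r * b) - l * q →
      α * ‖a‖ ^ 2 + ρ * ‖v‖ ^ 2 + β * ‖b‖ ^ 2 + σ * ‖q‖ ^ 2 = 1 →
      lam.re ≤ -(k * ξ ^ 2 / (1 + ξ ^ 2)) := by
  obtain ⟨k, hk, H⟩ := exists_rate_of_cross_estimates hα hρ hβ hσ hp hg hr hl hν
  refine ⟨k, hk, fun ξ hξ lam a v b q ha hv hb hq hE => ?_⟩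
  have hz : 0 < |ξ| := abs_pos.mpr hξ
  have hz2 : ξ ^ 2 = |ξ| ^ 2 := (sq_abs ξ).symm
  have energy : lam.re = -(l * ‖q‖ ^ 2 + ν * |ξ| ^ 2 * ‖v‖ ^ 2) := by
    have h := congrArg₂ (· + ·) (congrArg₂ (· + ·) (re_mul_normSq ha) (re_mul_normSq hv))
      (congrArg₂ (· + ·) (re_mul_normSq hb) (re_mul_normSq hq))
    have hE' : lam.re = lam.re * (α * ‖a‖ ^ 2 + ρ * ‖v‖ ^ 2 + β * ‖b‖ ^ 2 + σ * ‖q‖ ^ 2) := by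
      rw [hE, mul_one]
    simp only [← Complex.ofReal_pow] at h
    simp only [Complex.mul_re, Complex.mul_im, Complex.neg_re, Complex.neg_im, Complex.sub_re,
      Complex.sub_im, Complex.add_re, Complex.add_im, Complex.I_re, Complex.I_im,
      Complex.ofReal_re, Complex.ofReal_im, Complex.conj_re, Complex.conj_im] at h
    rw [sq_abs, ← Complex.normSq_eq_norm_sq q, ← Complex.normSq_eq_norm_sq v,
      Complex.normSq_apply, Complex.normSq_apply]
    linear_combination hE' + h
  have hD : 0 ≤ l * ‖q‖ ^ 2 + ν * |ξ| ^ 2 * ‖v‖ ^ 2 := by positivity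
  by_contra! hlt
  have hx : 0 ≤ -lam.re := by linarith
  have hxk : -lam.re * (1 + |ξ| ^ 2) ≤ k * |ξ| ^ 2 := by
    rw [hz2] at hlt
    rw [← le_div_iff₀ (by positivity)]
    linarith
  have hx₀ : -lam.re ≤ k := by
    refine le_of_mul_le_mul_right (a := 1 + |ξ| ^ 2) ?_ (by positivity)
    linarith
  have hx₂ : -lam.re ≤ k * |ξ| ^ 2 := by nlinarith [mul_nonneg hx (sq_nonneg |ξ|)]
  have hx₁ : 2 * |lam.re| ≤ |ξ| * k := by
    rw [abs_of_nonpos (by linarith)]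
    refine le_of_mul_le_mul_right (a := |ξ|) ?_ hz
    nlinarith [mul_nonneg hx (sq_nonneg (|ξ| - 1))]
  have nconj : ∀ w : ℂ, ‖conj w‖ = ‖w‖ := fun w => by simp
  have nα : ‖(α : ℂ)‖ = α := by simp [abs_of_pos hα]
  have nρ : ‖(ρ : ℂ)‖ = ρ := by simp [abs_of_pos hρ]
  have nβ : ‖(β : ℂ)‖ = β := by simp [abs_of_pos hβ]
  have nσ : ‖(σ : ℂ)‖ = σ := by simp [abs_of_pos hσ]
  have np : ‖(p : ℂ)‖ = p := by simp [abs_of_pos hp]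
  have ng : ‖(g : ℂ)‖ = g := by simp [abs_of_pos hg]
  have nr : ‖(r : ℂ)‖ = r := by simp [abs_of_pos hr]
  have nl : ‖(l : ℂ)‖ = l := by simp [abs_of_pos hl]
  have nν : ‖(ν : ℂ)‖ = ν := by simp [abs_of_nonneg hν]
  have nξ : ‖(ξ : ℂ)‖ = |ξ| := by simp
  have nx : ‖(2 * lam.re : ℂ)‖ = 2 * |lam.re| := by simp
  refine H ‖a‖ ‖v‖ ‖b‖ ‖q‖ |ξ| (norm_nonneg _) (norm_nonneg _) (norm_nonneg _) (norm_nonneg _) hz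
    hE (by linarith) (by linarith) ?_ ?_ ?_
  · have e : Complex.I * ξ * β * r * b * conj b = -(l * β * q * conj b)
        + Complex.I * ξ * σ * g * q * conj v + Complex.I * ξ * σ * r * q * conj q
        + -((2 * lam.re) * (β * σ * q * conj b)) := by
      have h := cross_term_identity hq hb
      simp only [map_mul, map_neg, map_add, Complex.conj_I, Complex.conj_ofReal] at h
      linear_combination -h
    have h := (congrArg norm e).trans_le norm_add₄_le
    simp only [norm_mul, norm_neg, nx, nconj, nβ, nσ, ng, nr, nl, nξ, Complex.norm_I] at h
    have h' := mul_le_mul_of_nonneg_right hx₁ (by positivity : 0 ≤ β * σ * ‖q‖ * ‖b‖)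
    linarith
  · have e : Complex.I * ξ * ρ * g * v * conj v = -(Complex.I * ξ * ρ * r * q * conj v)
        + Complex.I * ξ * β * b * (p * conj a + g * conj b)
        + -(β * ν * ξ ^ 2 * b * conj v)
        + -((2 * lam.re) * (ρ * β * b * conj v)) := by
      have h := cross_term_identity hb hv
      simp only [map_mul, map_neg, map_add, map_sub, map_pow, Complex.conj_I,
        Complex.conj_ofReal] at h
      linear_combination -h
    have h := (congrArg norm e).trans_le norm_add₄_le
    have hs : ‖p * conj a + g * conj b‖ ≤ p * ‖a‖ + g * ‖b‖ := by
      refine (norm_add_le _ _).trans_eq ?_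
      simp only [norm_mul, nconj, np, ng]
    simp only [norm_mul, norm_neg, norm_pow, nx, nconj, nβ, nρ, ng, nr, nν, nξ,
      Complex.norm_I] at h
    have h' := mul_le_mul_of_nonneg_right hx₁ (by positivity : 0 ≤ ρ * β * ‖b‖ * ‖v‖)
    have h'' := mul_le_mul_of_nonneg_left hs (by positivity : 0 ≤ |ξ| * β * ‖b‖)
    linarith
  · have e : Complex.I * ξ * α * p * a * conj a = -(Complex.I * ξ * α * g * b * conj a)
        + -(α * ν * ξ ^ 2 * v * conj a) + Complex.I * ξ * ρ * p * v * conj v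
        + -((2 * lam.re) * (α * ρ * v * conj a)) := by
      have h := cross_term_identity hv ha
      simp only [map_mul, map_neg, Complex.conj_I, Complex.conj_ofReal] at h
      linear_combination -h
    have h := (congrArg norm e).trans_le norm_add₄_le
    simp only [norm_mul, norm_neg, norm_pow, nx, nconj, nα, nρ, np, ng, nν, nξ,
      Complex.norm_I] at h
    have h' := mul_le_mul_of_nonneg_right hx₁ (by positivity : 0 ≤ α * ρ * ‖v‖ * ‖a‖)
    linarith

/-- Strict dissipativity of the linearized Cattaneo–Christov system (both in the
viscous case `ν > 0` and in the pure thermal relaxation case `ν = 0`): every root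
`λ` of the dispersion relation `det(λÂ⁰ + iξÂ¹ + L̂ + ξ²B̂) = 0` with `ξ ≠ 0`
satisfies `Re λ ≤ −kξ²/(1+ξ²) < 0` for a uniform constant `k > 0`. -/
theorem cattaneo_christov_strictly_dissipative (ρ θ τ κ eθ pρ pθ u ν : ℝ)
    (hρ : 0 < ρ) (hθ : 0 < θ) (hτ : 0 < τ) (hκ : 0 < κ)
    (heθ : 0 < eθ) (hpρ : 0 < pρ) (hpθ : 0 < pθ) (hν : 0 ≤ ν) :
    ∃ k : ℝ, 0 < k ∧ ∀ ξ : ℝ, ξ ≠ 0 → ∀ lam : ℂ,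
      (lam • (hatA0 ρ θ τ κ eθ pρ pθ u).map (Complex.ofReal)
          + (Complex.I * ξ) • (hatA1 ρ θ τ κ eθ pρ pθ u).map (Complex.ofReal)
          + (hatL θ κ).map (Complex.ofReal)
          + ((ξ : ℂ) ^ 2) • (hatB ν).map (Complex.ofReal)).det = 0 →
      lam.re ≤ -(k * ξ ^ 2 / (1 + ξ ^ 2)) ∧ lam.re < 0 := by
  have hα : 0 < pρ / ρ := by positivity
  have hβ : 0 < ρ * eθ / θ := by positivity
  have hσ : 0 < τ / (κ * θ) := by positivity
  obtain ⟨k, hk, H⟩ := exists_rate_of_unit_energy hα hρ hβ hσ hpρ hpθ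
    (by positivity : 0 < 1 / θ) (by positivity : 0 < 1 / (κ * θ)) hν
  refine ⟨k, hk, fun ξ hξ lam hdet => ?_⟩
  have hrate : 0 < k * ξ ^ 2 / (1 + ξ ^ 2) := by positivity
  suffices h : lam.re ≤ -(k * ξ ^ 2 / (1 + ξ ^ 2)) from ⟨h, by linarith⟩
  obtain ⟨w, hw, hMw⟩ := Matrix.exists_mulVec_eq_zero_iff.mpr hdet
  set E := pρ / ρ * ‖w 0‖ ^ 2 + ρ * ‖w 1‖ ^ 2 + ρ * eθ / θ * ‖w 2‖ ^ 2
    + τ / (κ * θ) * ‖w 3‖ ^ 2 with hE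
  have hE0 : 0 < E := by
    obtain ⟨i, hi⟩ := Function.ne_iff.mp hw
    have hi' : 0 < ‖w i‖ := norm_pos_iff.mpr hi
    fin_cases i <;> simp only [Fin.zero_eta, Fin.mk_one, Fin.reduceFinMk] at hi' <;> positivity
  have h0 := congrFun hMw 0
  have h1 := congrFun hMw 1
  have h2 := congrFun hMw 2
  have h3 := congrFun hMw 3
  simp [Matrix.mulVec, dotProduct, Fin.sum_univ_four, hatA0, hatA1, hatB, hatL] at h0 h1 h2 h3
  have hc : ((√E)⁻¹) ^ 2 * E = 1 := by
    rw [inv_pow, Real.sq_sqrt hE0.le, inv_mul_cancel₀ hE0.ne']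
  set c := (√E)⁻¹
  have key := H ξ hξ (lam + Complex.I * ξ * u) (c * w 0) (c * w 1) (c * w 2) (c * w 3)
    (by push_cast; linear_combination c * h0) (by linear_combination c * h1)
    (by push_cast; linear_combination c * h2) (by push_cast; linear_combination c * h3)
    (by
      simp only [norm_mul, Complex.norm_real, mul_pow, Real.norm_eq_abs, sq_abs]
      rw [← hc, hE]; ring)
  simpa using key
end
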